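/- arXiv:math/0405523 — 5 statements merged into one kernel-verified Lean document; each statement's English description precedes it below -/
import Mathlib

section
/- Let A be a commutative noetherian ring and let C be a semi-dualizing module for A. Then for every A-module M, viewed as an (A ⋉ C)-module via the projection A ⋉ C → A, and for every i ≥ 0, there is an isomorphism of abelian groups Ext^i_{A ⋉ C}(M, A ⋉ C) ≅ Ext^i_A(M, C). -/
open TrivSqZeroExt

/-- `Ext^i_R(M, N)` for modules `M`, `N` over a commutative ring `R`. -/
noncomputable abbrev ExtGroup (R : Type) [CommRing R] (i : ℕ)
    (M : Type) [AddCommGroup M] [Module R M] (N : Type) [AddCommGroup N] [Module R N] : Type :=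
  ((Ext R (ModuleCat R) i).obj (Opposite.op (ModuleCat.of R M))).obj (ModuleCat.of R N)

section
variable (A : Type) [CommRing A] (C : Type) [AddCommGroup C] [Module A C]

/-- Over a commutative ring every module is canonically a module over the opposite ring;
this provides the data needed for Mathlib's `TrivSqZeroExt A C` to be a commutative ring. -/
noncomputable instance : Module Aᵐᵒᵖ C :=
  Module.compHom C ((RingHom.id A).fromOpposite Commute.all)

instance : IsCentralScalar A C := ⟨fun _ _ => rfl⟩

/-- `C` is a semi-dualizing module for `A`: it is finitely generated, the canonical map
`A → Hom_A(C,C)`, `a ↦ (a • ·)`, is bijective, and `Ext^i_A(C,C) = 0` for `i ≥ 1`. -/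
def IsSemidualizing : Prop :=
  Module.Finite A C ∧ Function.Bijective (LinearMap.lsmul A C) ∧
    ∀ i : ℕ, 1 ≤ i → Subsingleton (ExtGroup A i C C)

/-- The `(A ⋉ C)`-module structure on `Hom_A(A ⋉ C, I)` coming from the `(A ⋉ C)`-action on
the first argument, `(r • f) x = f (r * x)`. -/
noncomputable instance homModule (I : Type) [AddCommGroup I] [Module A I] :
    Module (TrivSqZeroExt A C) (TrivSqZeroExt A C →ₗ[A] I) where
  smul r f := f ∘ₗ LinearMap.mulLeft A r
  one_smul f := by ext x; simp [HSMul.hSMul, SMul.smul]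
  mul_smul r s f := by ext x; simp [HSMul.hSMul, SMul.smul, mul_assoc, mul_left_comm]
  smul_zero r := by ext x; simp [HSMul.hSMul, SMul.smul]
  smul_add r f g := by ext x; simp [HSMul.hSMul, SMul.smul]
  add_smul r s f := by ext x; simp [HSMul.hSMul, SMul.smul, add_mul]
  zero_smul f := by ext x; simp [HSMul.hSMul, SMul.smul]

/-- An `A`-module viewed as an `(A ⋉ C)`-module via the projection `A ⋉ C → A`. -/
noncomputable def moduleOfFst (M : Type) [AddCommGroup M] [Module A M] :
    Module (TrivSqZeroExt A C) M :=
  Module.compHom M (fstHom A A C).toRingHom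

end

namespace CategoryTheory.Adjunction

open Abelian Limits

universe w w' v v' u u'

variable {C : Type u} [Category.{v} C] [Abelian C] [HasExt.{w} C]
  {D : Type u'} [Category.{v'} D] [Abelian D] [HasExt.{w'} D]
  {F : D ⥤ C} {G : C ⥤ D} (adj : F ⊣ G) [F.Additive] [PreservesFiniteLimits F]
  [PreservesFiniteColimits F]

/-- The comparison map `Ext X (G Y) n → Ext (F X) Y n` attached to an adjunction `F ⊣ G` whose
left adjoint is exact. -/
noncomputable def extMap (X : D) (Y : C) (n : ℕ) : Ext X (G.obj Y) n →+ Ext (F.obj X) Y n :=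
  ((Ext.mk₀ (adj.counit.app Y)).postcomp (F.obj X) (add_zero n)).comp
    (F.mapExtAddHom X (G.obj Y) n)

lemma extMap_apply {X : D} {Y : C} {n : ℕ} (x : Ext X (G.obj Y) n) :
    adj.extMap X Y n x =
      (x.mapExactFunctor F).comp (Ext.mk₀ (adj.counit.app Y)) (add_zero n) :=
  rfl

lemma extMap_comp_mk₀ {X : D} {Y Y' : C} {n : ℕ} (x : Ext X (G.obj Y) n) (g : Y ⟶ Y') :
    adj.extMap X Y' n (x.comp (Ext.mk₀ (G.map g)) (add_zero n)) =
      (adj.extMap X Y n x).comp (Ext.mk₀ g) (add_zero n) := by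
  simp [extMap_apply, Ext.mapExactFunctor_comp, Ext.mapExactFunctor_mk₀]

lemma mapExactFunctor_extClass_comp_counit {Y I Z : C} {f : Y ⟶ I} {g : I ⟶ Z} {w : f ≫ g = 0}
    (hS : (ShortComplex.mk f g w).ShortExact) {w' : G.map f ≫ G.map g = 0}
    (hGS : (ShortComplex.mk (G.map f) (G.map g) w').ShortExact) :
    (hGS.extClass.mapExactFunctor F).comp (Ext.mk₀ (adj.counit.app Y)) (add_zero 1) =
      (Ext.mk₀ (adj.counit.app Z)).comp hS.extClass (zero_add 1) := by
  rw [Ext.mapExactFunctor_extClass]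
  exact ShortComplex.ShortExact.extClass_naturality (hGS.map_of_exact F) hS
    { τ₁ := adj.counit.app Y
      τ₂ := adj.counit.app I
      τ₃ := adj.counit.app Z
      comm₁₂ := (adj.counit.naturality f).symm
      comm₂₃ := (adj.counit.naturality g).symm }

lemma extMap_comp_extClass {X : D} {Y I Z : C} {f : Y ⟶ I} {g : I ⟶ Z} {w : f ≫ g = 0}
    (hS : (ShortComplex.mk f g w).ShortExact) {w' : G.map f ≫ G.map g = 0}
    (hGS : (ShortComplex.mk (G.map f) (G.map g) w').ShortExact) {n m : ℕ} (h : n + 1 = m)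
    (x : Ext X (G.obj Z) n) :
    adj.extMap X Y m (x.comp hGS.extClass h) = (adj.extMap X Z n x).comp hS.extClass h := by
  rw [extMap_apply, extMap_apply, Ext.mapExactFunctor_comp, Ext.comp_assoc_of_third_deg_zero,
    mapExactFunctor_extClass_comp_counit adj hS hGS, Ext.comp_assoc_of_second_deg_zero]

lemma extMap_zero_bijective (X : D) (Y : C) : Function.Bijective (adj.extMap X Y 0) := by
  have h : ⇑(adj.extMap X Y 0) =
      Ext.homEquiv₀.symm ∘ (adj.homEquiv X Y).symm ∘ Ext.homEquiv₀ := by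
    ext x
    obtain ⟨f, rfl⟩ := (Ext.mk₀_bijective _ _).2 x
    simp [extMap_apply, Ext.mapExactFunctor_mk₀, Ext.homEquiv₀, adj.homEquiv_counit]
  rw [h]
  exact (Equiv.bijective _).comp ((Equiv.bijective _).comp (Equiv.bijective _))

/-- If `F ⊣ G` with `F` exact, the comparison map `Ext X (G Y) n → Ext (F X) Y n` is bijective for
all objects `Y` of a class admitting injective coresolutions which remain exact under `G`. -/
theorem extMap_bijective (P : C → Prop)
    (hP : ∀ Y, P Y → ∃ (I Z : C) (f : Y ⟶ I) (g : I ⟶ Z) (w : f ≫ g = 0)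
      (w' : G.map f ≫ G.map g = 0), (ShortComplex.mk f g w).ShortExact ∧
      (ShortComplex.mk (G.map f) (G.map g) w').ShortExact ∧ Injective I ∧ P I ∧ P Z)
    (X : D) (n : ℕ) (Y : C) (hY : P Y) : Function.Bijective (adj.extMap X Y n) := by
  induction n generalizing Y with
  | zero => exact adj.extMap_zero_bijective X Y
  | succ n ih =>
    obtain ⟨I, Z, f, g, w, w', hS, hGS, hI, hPI, hPZ⟩ := hP Y hY
    constructor
    · rw [injective_iff_map_eq_zero]
      intro x hx
      have : Injective (G.obj I) := adj.map_injective _ hI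
      obtain ⟨y, rfl⟩ := Ext.covariant_sequence_exact₁ X hGS x (Ext.eq_zero_of_injective _) rfl
      rw [extMap_comp_extClass adj hS hGS rfl] at hx
      obtain ⟨z, hz⟩ := Ext.covariant_sequence_exact₃ _ hS _ rfl hx
      obtain ⟨z', rfl⟩ := (ih _ hPI).2 z
      dsimp only at hz
      rw [← extMap_comp_mk₀] at hz
      obtain rfl := (ih _ hPZ).1 hz
      rw [Ext.comp_assoc_of_second_deg_zero, hGS.comp_extClass, Ext.comp_zero]
    · intro x
      obtain ⟨y, rfl⟩ := Ext.covariant_sequence_exact₁ _ hS x (Ext.eq_zero_of_injective _) rfl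
      obtain ⟨y', rfl⟩ := (ih _ hPZ).2 y
      exact ⟨_, adj.extMap_comp_extClass hS hGS rfl y'⟩

end CategoryTheory.Adjunction

namespace CategoryTheory.ProjectiveResolution

universe w v u

variable {R : Type} [CommRing R] {X : ModuleCat.{0} R} (P : ProjectiveResolution X)
  (Y : ModuleCat.{0} R) (n : ℕ)

lemma extMk_zero_eq_zero_iff {C : Type u} [Category.{v} C] [Abelian C] [HasExt.{w} C] {X Y : C}
    (P : ProjectiveResolution X) (f : P.complex.X 0 ⟶ Y) (hf : P.complex.d 1 0 ≫ f = 0) :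
    P.extMk f 1 rfl hf = 0 ↔ f = 0 := by
  refine ⟨fun h ↦ ?_, fun h ↦ by simp [h]⟩
  rw [← P.extEquivCohomologyClass.apply_eq_iff_eq, extEquivCohomologyClass_extMk,
    extEquivCohomologyClass_zero, CochainComplex.HomComplex.CohomologyClass.mk_eq_zero_iff,
    CochainComplex.HomComplex.Cocycle.toSingleMk_mem_coboundaries_iff _ _ _ _ _ 1 (by simp)] at h
  obtain ⟨g, hg⟩ := h
  rw [(P.cochainComplex.isZero_of_isStrictlyLE 0 1).eq_of_src g 0, Limits.comp_zero] at hg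
  exact (cancel_epi (P.cochainComplexXIso (-(0 : ℕ)) 0 rfl).hom).1
    (hg.symm.trans Limits.comp_zero.symm)

/-- The group of `n`-cocycles of `Hom(P, Y)` maps onto `Ext X Y n`. -/
noncomputable def extMkHom :
    LinearMap.ker ((P.complex.linearYonedaObj R Y).sc' (n - 1) n (n + 1)).g.hom →+
      Abelian.Ext X Y n where
  toFun f := P.extMk (show P.complex.X n ⟶ Y from f.1) (n + 1) rfl f.2
  map_zero' := P.extMk_zero _ _
  map_add' _ _ := (P.add_extMk _ _ _ _ _ _).symm

lemma extMkHom_surjective : Function.Surjective (P.extMkHom Y n) := fun α ↦ by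
  obtain ⟨f, hf, rfl⟩ := P.extMk_surjective α (n + 1) rfl
  exact ⟨⟨f, hf⟩, rfl⟩

lemma ker_extMkHom : (P.extMkHom Y n).ker = (LinearMap.range
    ((P.complex.linearYonedaObj R Y).sc' (n - 1) n (n + 1)).moduleCatToCycles).toAddSubgroup := by
  ext ⟨f, hf⟩
  cases n with
  | zero =>
    refine (P.extMk_zero_eq_zero_iff (show P.complex.X 0 ⟶ Y from f) hf).trans
      ⟨fun h ↦ ⟨0, (map_zero _).trans (Subtype.ext h.symm)⟩, ?_⟩
    rintro ⟨g, hg⟩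
    refine (congrArg Subtype.val hg).symm.trans (?_ : P.complex.d 0 0 ≫ g = 0)
    rw [P.complex.shape 0 0 (by simp)]
    exact Limits.zero_comp
  | succ p =>
    refine (P.extMk_eq_zero_iff (show P.complex.X (p + 1) ⟶ Y from f) _ rfl hf p rfl).trans ?_
    exact exists_congr fun g ↦ ⟨fun h ↦ Subtype.ext h, fun h ↦ congrArg Subtype.val h⟩

/-- The two definitions of `Ext` in Mathlib agree for modules. -/
noncomputable def extAddEquiv :
    ((Ext R (ModuleCat.{0} R) n).obj (Opposite.op X)).obj Y ≃+ Abelian.Ext X Y n :=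
  let K := P.complex.linearYonedaObj R Y
  (P.isoExt n Y ≪≫ ShortComplex.homologyMapIso
    (K.isoSc' (n - 1) n (n + 1) (by cases n <;> simp) (by simp)) ≪≫
    (K.sc' (n - 1) n (n + 1)).moduleCatHomologyIso).toLinearEquiv.toAddEquiv.trans
  ((QuotientAddGroup.quotientAddEquivOfEq (P.ker_extMkHom Y n).symm).trans
    (QuotientAddGroup.quotientKerEquivOfSurjective _ (P.extMkHom_surjective Y n)))

end CategoryTheory.ProjectiveResolution

section Coextension

open CategoryTheory

variable {A : Type} [CommRing A] {C : Type} [AddCommGroup C] [Module A C]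

/-- If homotheties give `A ≃ Hom_A(C, C)`, then `A ⋉ C` is coextended from the `A`-module `C`. -/
lemma nonempty_iso_coextendScalars (hC : Function.Bijective (LinearMap.lsmul A C)) :
    Nonempty (ModuleCat.of (TrivSqZeroExt A C) (TrivSqZeroExt A C) ≅
      (ModuleCat.coextendScalars.{0, 0, 0} (inlHom A C)).obj (ModuleCat.of A C)) := by
  let B := (ModuleCat.restrictScalars (inlHom A C)).obj
    (ModuleCat.of (TrivSqZeroExt A C) (TrivSqZeroExt A C))
  let s : B ⟶ ModuleCat.of A C := ModuleCat.ofHom (X := B)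
    { toFun := fun x : TrivSqZeroExt A C ↦ x.snd
      map_add' := fun _ _ ↦ rfl
      map_smul' := fun a (x : TrivSqZeroExt A C) ↦ by
        change (inlHom A C a * x).snd = a • x.snd
        simp }
  let φ := ModuleCat.RestrictionCoextensionAdj.HomEquiv.fromRestriction (inlHom A C) s
  have hφ (x y : TrivSqZeroExt A C) :
      ModuleCat.CoextendScalars.equiv _ _ (φ.hom x) y = (y * x).snd := rfl
  have : IsIso φ := by
    rw [ConcreteCategory.isIso_iff_bijective]
    constructor
    · refine (injective_iff_map_eq_zero φ.hom).2 fun x hx ↦ ?_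
      have hx' (y : TrivSqZeroExt A C) : (y * x).snd = 0 := by
        rw [← hφ, hx]
        rfl
      refine TrivSqZeroExt.ext (hC.1 (LinearMap.ext fun c ↦ ?_)) (by simpa using hx' 1)
      simpa using hx' (inr c)
    · intro g
      let h : TrivSqZeroExt A C → C := fun y ↦ ModuleCat.CoextendScalars.equiv _ _ g y
      have hadd (y z : TrivSqZeroExt A C) : h (y + z) = h y + h z :=
        map_add (ModuleCat.CoextendScalars.equiv _ _ g) y z
      have hsmul (a : A) (y : TrivSqZeroExt A C) : h (inl a * y) = a • h y :=
        (ModuleCat.CoextendScalars.equiv _ _ g).map_smul' a y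
      obtain ⟨a, ha⟩ := hC.2
        { toFun := fun c ↦ h (inr c)
          map_add' := fun c d ↦ by rw [inr_add, hadd]
          map_smul' := fun a c ↦ by rw [← inl_mul_inr, hsmul, RingHom.id_apply] }
      have ha (c : C) : a • c = h (inr c) := LinearMap.congr_fun ha c
      refine ⟨inl a + inr (h 1), ModuleCat.CoextendScalars.ext
        (LinearMap.ext fun y : TrivSqZeroExt A C ↦ (hφ _ y).trans ?_)⟩
      change _ = h y
      have hy : h y = y.fst • h 1 + h (inr y.snd) := by
        rw [← hsmul, mul_one, ← hadd, inl_fst_add_inr_snd_eq]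
      rw [hy, ← ha]
      simp
  exact ⟨asIso φ⟩

/-- Coextension to `A ⋉ C` preserves the exactness of a short exact sequence of `A`-modules whose
left term `Y` satisfies `Ext¹(C, Y) = 0`. -/
lemma shortExact_map_coextendScalars {S : ShortComplex (ModuleCat.{0} A)} (hS : S.ShortExact)
    (hE : Subsingleton (Abelian.Ext (ModuleCat.of A C) S.X₁ 1)) :
    (S.map (ModuleCat.coextendScalars.{0, 0, 0} (inlHom A C))).ShortExact := by
  have := (ModuleCat.restrictCoextendScalarsAdj.{0, 0, 0}
    (inlHom A C)).rightAdjoint_preservesLimits.{0, 0}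
  have := hS.mono_f
  have := hS.epi_g
  refine
    { exact := hS.exact.map_of_mono_of_preservesKernel _ inferInstance inferInstance
      mono_f := inferInstanceAs (Mono ((ModuleCat.coextendScalars.{0, 0, 0} (inlHom A C)).map S.f))
      epi_g := ?_ }
  rw [ModuleCat.epi_iff_surjective]
  intro g
  let h : TrivSqZeroExt A C → S.X₃ := fun y ↦ ModuleCat.CoextendScalars.equiv _ _ g y
  have hadd (y z : TrivSqZeroExt A C) : h (y + z) = h y + h z :=
    map_add (ModuleCat.CoextendScalars.equiv _ _ g) y z
  have hsmul (a : A) (y : TrivSqZeroExt A C) : h (inl a * y) = a • h y :=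
    (ModuleCat.CoextendScalars.equiv _ _ g).map_smul' a y
  let k : ModuleCat.of A C ⟶ S.X₃ := ModuleCat.ofHom
    { toFun := fun c ↦ h (inr c)
      map_add' := fun c d ↦ by rw [inr_add, hadd]
      map_smul' := fun a c ↦ by rw [← inl_mul_inr, hsmul, RingHom.id_apply] }
  obtain ⟨x, hx⟩ := Abelian.Ext.covariant_sequence_exact₃ _ hS (Abelian.Ext.mk₀ k) (zero_add 1)
    (Subsingleton.elim _ _)
  obtain ⟨l, rfl⟩ := (Abelian.Ext.mk₀_bijective _ _).2 x
  rw [Abelian.Ext.mk₀_comp_mk₀] at hx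
  have hl (c : C) : S.g (l c) = h (inr c) :=
    congrArg (fun f : ModuleCat.of A C ⟶ S.X₃ ↦ f c) ((Abelian.Ext.mk₀_bijective _ _).1 hx)
  obtain ⟨i, hi⟩ := (ModuleCat.epi_iff_surjective S.g).1 inferInstance (h 1)
  let t : (ModuleCat.restrictScalars (inlHom A C)).obj
      (ModuleCat.of (TrivSqZeroExt A C) (TrivSqZeroExt A C)) →ₗ[A] S.X₂ :=
    { toFun := fun y : TrivSqZeroExt A C ↦ y.fst • i + l y.snd
      map_add' := fun (y z : TrivSqZeroExt A C) ↦ by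
        change (y.fst + z.fst) • i + l (y.snd + z.snd) =
          (y.fst • i + l y.snd) + (z.fst • i + l z.snd)
        rw [map_add, add_smul, add_add_add_comm]
      map_smul' := fun a (y : TrivSqZeroExt A C) ↦ by
        change (inlHom A C a * y).fst • i + l (inlHom A C a * y).snd = a • (y.fst • i + l y.snd)
        simp [mul_smul] }
  refine ⟨(ModuleCat.CoextendScalars.equiv _ _).symm t, ModuleCat.CoextendScalars.ext
    (LinearMap.ext fun y : TrivSqZeroExt A C ↦ ?_)⟩
  change S.g (y.fst • i + l y.snd) = h y
  rw [map_add, map_smul, hi, hl, ← hsmul, mul_one, ← hadd, inl_fst_add_inr_snd_eq]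

/-- If `Ext^n(C, Y) = 0` for `n ≥ 1`, then `Y` embeds into an injective module such that the
resulting short exact sequence stays exact under coextension to `A ⋉ C`, and the quotient has the
same vanishing property. -/
lemma exists_injective_shortExact_coextendScalars (Y : ModuleCat.{0} A)
    (hY : ∀ n, Subsingleton (Abelian.Ext (ModuleCat.of A C) Y (n + 1))) :
    ∃ (I Z : ModuleCat.{0} A) (f : Y ⟶ I) (g : I ⟶ Z) (w : f ≫ g = 0)
      (w' : (ModuleCat.coextendScalars.{0, 0, 0} (inlHom A C)).map f ≫
        (ModuleCat.coextendScalars.{0, 0, 0} (inlHom A C)).map g = 0),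
      (ShortComplex.mk f g w).ShortExact ∧ (ShortComplex.mk _ _ w').ShortExact ∧ Injective I ∧
      (∀ n, Subsingleton (Abelian.Ext (ModuleCat.of A C) I (n + 1))) ∧
      ∀ n, Subsingleton (Abelian.Ext (ModuleCat.of A C) Z (n + 1)) := by
  have hS : (ShortComplex.mk (Injective.ι Y) (Limits.cokernel.π (Injective.ι Y))
      (Limits.cokernel.condition _)).ShortExact :=
    { exact := ShortComplex.exact_cokernel _ }
  have hI (n : ℕ) :
      Subsingleton (Abelian.Ext (ModuleCat.of A C) (Injective.under Y) (n + 1)) :=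
    Abelian.Ext.subsingleton_of_injective _ _ _
  refine ⟨_, _, _, _, _, _, hS, shortExact_map_coextendScalars hS (hY 0), inferInstance, hI,
    fun n ↦ subsingleton_of_forall_eq 0 fun x ↦ ?_⟩
  obtain ⟨y, rfl⟩ := Abelian.Ext.covariant_sequence_exact₃ _ hS x rfl
    ((hY (n + 1)).elim _ _)
  rw [(hI n).elim y 0, Abelian.Ext.zero_comp]

/-- Restricting the `(A ⋉ C)`-module structure `moduleOfFst` on `M` along `A → A ⋉ C` gives back
the `A`-module `M`. -/
noncomputable def restrictScalarsInlHomIso (A : Type) [CommRing A] (C : Type) [AddCommGroup C]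
    [Module A C] (M : Type) [AddCommGroup M] [Module A M] :
    letI : Module (TrivSqZeroExt A C) M := moduleOfFst A C M
    (ModuleCat.restrictScalars (inlHom A C)).obj (ModuleCat.of (TrivSqZeroExt A C) M) ≅
      ModuleCat.of A M :=
  letI : Module (TrivSqZeroExt A C) M := moduleOfFst A C M
  let e : (ModuleCat.restrictScalars (inlHom A C)).obj (ModuleCat.of (TrivSqZeroExt A C) M) ≃ₗ[A]
      ModuleCat.of A M :=
    { AddEquiv.refl M with map_smul' := fun _ _ ↦ rfl }
  e.toModuleIso

end Coextension

/-- If `A` is a commutative noetherian ring and `C` a semi-dualizing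
`A`-module, then for every `A`-module `M`, viewed as an `(A ⋉ C)`-module via the projection
`A ⋉ C → A`, and every `i ≥ 0`, there is an isomorphism of abelian groups
`Ext^i_{A ⋉ C}(M, A ⋉ C) ≅ Ext^i_A(M, C)`. -/
theorem ext_trivSqZeroExt_iso_ext
    (A : Type) [CommRing A] [IsNoetherianRing A] (C : Type) [AddCommGroup C] [Module A C]
    (hC : IsSemidualizing A C)
    (M : Type) [AddCommGroup M] [Module A M] (i : ℕ) :
    letI : Module (TrivSqZeroExt A C) M := moduleOfFst A C M
    Nonempty (ExtGroup (TrivSqZeroExt A C) i M (TrivSqZeroExt A C) ≃+ ExtGroup A i M C) := by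
  let _ : Module (TrivSqZeroExt A C) M := moduleOfFst A C M
  obtain ⟨-, hbij, hvan⟩ := hC
  obtain ⟨e⟩ := nonempty_iso_coextendScalars hbij
  have hvan' (n : ℕ) :
      Subsingleton (CategoryTheory.Abelian.Ext (ModuleCat.of A C) (ModuleCat.of A C) (n + 1)) :=
    have := hvan (n + 1) (by lia)
    ((CategoryTheory.projectiveResolution _).extAddEquiv _ _).symm.subsingleton
  have hmap := (ModuleCat.restrictCoextendScalarsAdj.{0, 0, 0} (inlHom A C)).extMap_bijective _
    (exists_injective_shortExact_coextendScalars (C := C))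
    (ModuleCat.of (TrivSqZeroExt A C) M) i _ hvan'
  exact ⟨(((Ext _ _ i).obj _).mapIso e).toLinearEquiv.toAddEquiv.trans <|
    ((CategoryTheory.projectiveResolution _).extAddEquiv _ _).trans <|
    (AddEquiv.ofBijective _ hmap).trans <|
    ((CategoryTheory.projectiveResolution _).extAddEquiv _ _).symm.trans
    (((Ext _ _ i).mapIso (restrictScalarsInlHomIso A C M).symm.op).app _).toLinearEquiv.toAddEquiv⟩
end

section
/- Let A be a commutative noetherian ring and let C be a semi-dualizing module for A. Then, viewing A as an (A ⋉ C)-module via the projection A ⋉ C → A, there is an isomorphism of (A ⋉ C)-modules Hom_{A ⋉ C}(A, A ⋉ C) ≅ C, and Ext^i_{A ⋉ C}(A, A ⋉ C) = 0 for all i ≥ 1. -/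
open TrivSqZeroExt

open CategoryTheory

/-- Both definitions of `Ext` in Mathlib vanish in the same positive degrees. -/
lemma subsingleton_extGroup_succ_iff {R : Type} [CommRing R] (M N : Type)
    [AddCommGroup M] [Module R M] [AddCommGroup N] [Module R N] (n : ℕ) :
    Subsingleton (ExtGroup R (n + 1) M N) ↔
      Subsingleton (Abelian.Ext (ModuleCat.of R M) (ModuleCat.of R N) (n + 1)) := by
  let P := projectiveResolution (ModuleCat.of R M)
  have h₁ : Subsingleton (ExtGroup R (n + 1) M N) ↔
      ∀ f : P.complex.X (n + 1) ⟶ ModuleCat.of R N, P.complex.d (n + 2) (n + 1) ≫ f = 0 →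
        ∃ g : P.complex.X n ⟶ ModuleCat.of R N, P.complex.d (n + 1) n ≫ g = f := by
    rw [(P.isoExt (n + 1) (ModuleCat.of R N)).toLinearEquiv.toEquiv.subsingleton_congr,
      ← ModuleCat.isZero_iff_subsingleton, ← HomologicalComplex.exactAt_iff_isZero_homology,
      HomologicalComplex.exactAt_iff' _ n (n + 1) (n + 2) (by simp) (by simp),
      ShortComplex.moduleCat_exact_iff]
    rfl
  rw [h₁]
  constructor
  · refine fun h ↦ subsingleton_of_forall_eq 0 fun x ↦ ?_
    obtain ⟨f, hf, rfl⟩ := P.extMk_surjective x (n + 2) rfl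
    exact (P.extMk_eq_zero_iff f (n + 2) rfl hf n rfl).2 (h f hf)
  · intro h f hf
    exact (P.extMk_eq_zero_iff f (n + 2) rfl hf n rfl).1 (Subsingleton.elim _ _)

/-- If the identity of `V` is a finite sum of maps factoring through objects `W i` whose `Ext`
into `Y` vanishes, then so does that of `V`. -/
lemma subsingleton_ext_of_sum_eq_id {𝒞 : Type*} [Category* 𝒞] [Abelian 𝒞] [HasExt 𝒞]
    {ι : Type*} [Fintype ι] {V Y : 𝒞} {W : ι → 𝒞} (p : ∀ i, V ⟶ W i) (q : ∀ i, W i ⟶ V)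
    (hpq : ∑ i, p i ≫ q i = 𝟙 V) (n : ℕ) (h : ∀ i, Subsingleton (Abelian.Ext (W i) Y n)) :
    Subsingleton (Abelian.Ext V Y n) := by
  refine subsingleton_of_forall_eq 0 fun x ↦ ?_
  rw [← x.mk₀_id_comp, ← hpq, Abelian.Ext.mk₀_sum, Abelian.Ext.sum_comp]
  refine Finset.sum_eq_zero fun i _ ↦ ?_
  rw [← Abelian.Ext.mk₀_comp_mk₀, Abelian.Ext.comp_assoc_of_second_deg_zero,
    Subsingleton.elim ((Abelian.Ext.mk₀ (q i)).comp x (zero_add n)) 0, Abelian.Ext.comp_zero]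

section
variable (A : Type) [CommRing A] (C : Type) [AddCommGroup C] [Module A C]

/-- Restriction of scalars along `A → A ⋉ C`. -/
noncomputable abbrev restrictInl : ModuleCat.{0} (TrivSqZeroExt A C) ⥤ ModuleCat.{0} A :=
  ModuleCat.restrictScalars (inlHom A C)

variable {A C}

lemma isNoetherianRing_trivSqZeroExt [IsNoetherianRing A] [Module.Finite A C] :
    IsNoetherianRing (TrivSqZeroExt A C) := by
  have : Module.Finite A (TrivSqZeroExt A C) := inferInstanceAs (Module.Finite A (A × C))
  exact IsNoetherianRing.of_finite A _

lemma smul_eq_inl_smul_add_inr_smul {M : Type} [AddCommGroup M] [Module (TrivSqZeroExt A C) M]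
    (r : TrivSqZeroExt A C) (m : M) :
    r • m = (inl r.fst : TrivSqZeroExt A C) • m + (inr r.snd : TrivSqZeroExt A C) • m := by
  rw [← add_smul, inl_fst_add_inr_snd_eq]

lemma linearMap_ext_of_snd (hinj : Function.Injective (LinearMap.lsmul A C))
    {M : Type} [AddCommGroup M] [Module (TrivSqZeroExt A C) M]
    {φ ψ : M →ₗ[TrivSqZeroExt A C] TrivSqZeroExt A C} (h : ∀ m, (φ m).snd = (ψ m).snd) :
    φ = ψ := by
  ext m
  · apply hinj
    ext c
    have := h ((inr c : TrivSqZeroExt A C) • m)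
    simpa using this
  · exact h m

/-- If `A → Hom_A(C, C)` is bijective, then every `A`-linear map to `C` from an
`(A ⋉ C)`-module lifts to an `(A ⋉ C)`-linear map to `A ⋉ C`. -/
lemma exists_linearMap_snd_eq (hC : Function.Bijective (LinearMap.lsmul A C))
    {M : ModuleCat.{0} (TrivSqZeroExt A C)} (g : (restrictInl A C).obj M ⟶ ModuleCat.of A C) :
    ∃ φ : M →ₗ[TrivSqZeroExt A C] TrivSqZeroExt A C, ∀ m : M, (φ m).snd = g m := by
  let g' : M →+ C := g.hom.toAddMonoidHom
  have hg : ∀ (a : A) (m : M), g' ((inl a : TrivSqZeroExt A C) • m) = a • g' m :=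
    fun a m ↦ g.hom.map_smul a m
  let e (m : M) : C →ₗ[A] C :=
    { toFun := fun c ↦ g' ((inr c : TrivSqZeroExt A C) • m)
      map_add' := fun c d ↦ by rw [inr_add, add_smul, map_add]
      map_smul' := fun a c ↦ by
        rw [← hg, smul_smul, inl_mul_inr]; rfl }
  choose f hf using fun m ↦ hC.2 (e m)
  have hf' : ∀ m c, f m • c = g' ((inr c : TrivSqZeroExt A C) • m) :=
    fun m c ↦ LinearMap.congr_fun (hf m) c
  refine ⟨{ toFun := fun m ↦ inl (f m) + inr (g' m), map_add' := ?_, map_smul' := ?_ }, ?_⟩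
  · intro m n
    ext
    · apply hC.1
      ext c
      simp [hf']
    · simp
  · intro r m
    ext
    · apply hC.1
      ext c
      have hr : (inr c : TrivSqZeroExt A C) * r = inr (r.fst • c) := by ext <;> simp
      have := congrArg (fun s ↦ g' (s • m)) hr
      simp only [mul_smul, ← hf'] at this
      simpa [mul_smul, smul_comm (f m)] using this
    · rw [smul_eq_inl_smul_add_inr_smul]
      simp [hg, hf']
  · intro m
    simp only [LinearMap.coe_mk, AddHom.coe_mk, snd_add, snd_inl, snd_inr, zero_add]
    rfl

/-- `Ext_A^n(-, C)` vanishes on finite free `(A ⋉ C)`-modules as soon as it does on `C`. -/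
lemma subsingleton_ext_restrictInl_of_free {n : ℕ}
    (hC : Subsingleton (Abelian.Ext (ModuleCat.of A C) (ModuleCat.of A C) (n + 1)))
    (P : ModuleCat.{0} (TrivSqZeroExt A C)) [Module.Free (TrivSqZeroExt A C) P]
    [Module.Finite (TrivSqZeroExt A C) P] :
    Subsingleton (Abelian.Ext ((restrictInl A C).obj P) (ModuleCat.of A C) (n + 1)) := by
  let R := TrivSqZeroExt A C
  let b := Module.Free.chooseBasis R P
  let W : ModuleCat.{0} A := ModuleCat.of A R
  have hW : Subsingleton (Abelian.Ext W (ModuleCat.of A C) (n + 1)) := by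
    refine subsingleton_ext_of_sum_eq_id (ι := Bool)
      (W := fun i ↦ bif i then ModuleCat.of A A else ModuleCat.of A C)
      (fun i ↦ match i with
        | true => ModuleCat.ofHom (fstHom A A C).toLinearMap
        | false => ModuleCat.ofHom (sndHom A C))
      (fun i ↦ match i with
        | true => ModuleCat.ofHom (inlAlgHom A A C).toLinearMap
        | false => ModuleCat.ofHom (inrHom A C)) ?_ _ ?_
    · rw [Fintype.sum_bool]
      ext1
      exact LinearMap.ext fun r ↦ inl_fst_add_inr_snd_eq r
    · rintro (_ | _)
      · exact hC
      · exact Abelian.Ext.subsingleton_of_projective (ModuleCat.of A A) _ _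
  refine subsingleton_ext_of_sum_eq_id (W := fun _ ↦ W)
    (fun i ↦ ModuleCat.ofHom (X := (restrictInl A C).obj P) (Y := R)
      { toFun := fun x ↦ b.coord i x
        map_add' := map_add (b.coord i)
        map_smul' := fun a x ↦ (map_smul (b.coord i) (inl a : R) x).trans (inl_mul_eq_smul a _) })
    (fun i ↦ ModuleCat.ofHom (X := R) (Y := (restrictInl A C).obj P)
      { toFun := fun r ↦ (r • b i : P)
        map_add' := fun r s ↦ add_smul r s (b i)
        map_smul' := fun a r ↦ by
          rw [← inl_mul_eq_smul, mul_smul]; rfl }) ?_ _ fun _ ↦ hW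
  ext x
  rw [ModuleCat.hom_sum, LinearMap.sum_apply]
  exact b.sum_repr x

/-- The `A`-linear projection `A ⋉ C → C`. -/
noncomputable def sndRestrict :
    (restrictInl A C).obj (ModuleCat.of (TrivSqZeroExt A C) (TrivSqZeroExt A C)) ⟶
      ModuleCat.of A C :=
  ModuleCat.ofHom
    (X := (restrictInl A C).obj (ModuleCat.of (TrivSqZeroExt A C) (TrivSqZeroExt A C)))
    { toFun := fun r : TrivSqZeroExt A C ↦ r.snd
      map_add' := fun _ _ ↦ rfl
      map_smul' := fun a r ↦ congrArg snd (inl_mul_eq_smul a r) }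

lemma subsingleton_ext_one_of_restrictInl (hC : Function.Bijective (LinearMap.lsmul A C))
    {S : ShortComplex (ModuleCat.{0} (TrivSqZeroExt A C))} (hS : S.ShortExact) [Projective S.X₂]
    (h : Subsingleton (Abelian.Ext ((S.map (restrictInl A C)).X₃) (ModuleCat.of A C) 1)) :
    Subsingleton
      (Abelian.Ext S.X₃ (ModuleCat.of (TrivSqZeroExt A C) (TrivSqZeroExt A C)) 1) := by
  refine subsingleton_of_forall_eq 0 fun x ↦ ?_
  obtain ⟨y, rfl⟩ := Abelian.Ext.contravariant_sequence_exact₃ hS _ x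
    (Abelian.Ext.eq_zero_of_projective _) (add_comm 1 0)
  obtain ⟨φ, rfl⟩ := (Abelian.Ext.mk₀_bijective _ _).2 y
  have hS' := hS.map_of_exact (restrictInl A C)
  let g : (S.map (restrictInl A C)).X₁ ⟶ ModuleCat.of A C :=
    (restrictInl A C).map φ ≫ sndRestrict
  obtain ⟨z, hz⟩ := Abelian.Ext.contravariant_sequence_exact₁ hS' _ (Abelian.Ext.mk₀ g)
    (add_comm 1 0) (h.elim _ _)
  obtain ⟨ψ, rfl⟩ := (Abelian.Ext.mk₀_bijective _ _).2 z
  rw [Abelian.Ext.mk₀_comp_mk₀, (Abelian.Ext.mk₀_bijective _ _).1.eq_iff] at hz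
  obtain ⟨ψ', hψ'⟩ := exists_linearMap_snd_eq hC (M := S.X₂) ψ
  have hφ : φ = S.f ≫ ModuleCat.ofHom ψ' := by
    ext1
    refine linearMap_ext_of_snd hC.1 fun m ↦ ?_
    exact (ConcreteCategory.congr_hom hz m).symm.trans (hψ' _).symm
  rw [hφ, ← Abelian.Ext.mk₀_comp_mk₀, hS.extClass_comp_assoc]

lemma subsingleton_ext_X₁ {𝒞 : Type*} [Category* 𝒞] [Abelian 𝒞] [HasExt 𝒞]
    {S : ShortComplex 𝒞} (hS : S.ShortExact) {Y : 𝒞} {n : ℕ}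
    (h₂ : Subsingleton (Abelian.Ext S.X₂ Y n)) (h₃ : Subsingleton (Abelian.Ext S.X₃ Y (n + 1))) :
    Subsingleton (Abelian.Ext S.X₁ Y n) := by
  refine subsingleton_of_forall_eq 0 fun x ↦ ?_
  obtain ⟨y, rfl⟩ := Abelian.Ext.contravariant_sequence_exact₁ hS _ x (add_comm 1 n) (h₃.elim _ _)
  rw [h₂.elim y 0, Abelian.Ext.comp_zero]

lemma subsingleton_ext_of_restrictInl [IsNoetherianRing A] [Module.Finite A C]
    (hC : Function.Bijective (LinearMap.lsmul A C))
    (hExt : ∀ n, Subsingleton (Abelian.Ext (ModuleCat.of A C) (ModuleCat.of A C) (n + 1)))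
    (n : ℕ) (M : ModuleCat.{0} (TrivSqZeroExt A C)) [Module.Finite (TrivSqZeroExt A C) M]
    (hM : ∀ k, Subsingleton
      (Abelian.Ext ((restrictInl A C).obj M) (ModuleCat.of A C) (k + 1))) :
    Subsingleton
      (Abelian.Ext M (ModuleCat.of (TrivSqZeroExt A C) (TrivSqZeroExt A C)) (n + 1)) := by
  have := isNoetherianRing_trivSqZeroExt (A := A) (C := C)
  induction n generalizing M with
  | zero =>
    obtain ⟨P, _, _, _, _, f, hf⟩ := Module.exists_finite_presentation (TrivSqZeroExt A C) M
    exact subsingleton_ext_one_of_restrictInl hC (LinearMap.shortExact_shortComplexKer hf) (hM 0)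
  | succ n ih =>
    obtain ⟨P, _, _, _, _, f, hf⟩ := Module.exists_finite_presentation (TrivSqZeroExt A C) M
    have hS := LinearMap.shortExact_shortComplexKer hf
    have hK := ih (ModuleCat.of _ (LinearMap.ker f)) fun k ↦
      subsingleton_ext_X₁ (hS.map_of_exact (restrictInl A C))
        (subsingleton_ext_restrictInl_of_free (hExt k) (ModuleCat.of _ P)) (hM (k + 1))
    exact (precomp_extClass_surjective_of_projective_X₂ _ hS (n + 1)).subsingleton

end

/-- If `A` is a commutative noetherian ring and `C` a semi-dualizing
`A`-module, then, viewing `A` as an `(A ⋉ C)`-module via the projection, there is an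
isomorphism of `(A ⋉ C)`-modules `Hom_{A ⋉ C}(A, A ⋉ C) ≅ C`, and
`Ext^i_{A ⋉ C}(A, A ⋉ C) = 0` for all `i ≥ 1`. -/
theorem hom_over_trivSqZeroExt_iso
    (A : Type) [CommRing A] [IsNoetherianRing A] (C : Type) [AddCommGroup C] [Module A C]
    (hC : IsSemidualizing A C) :
    letI : Module (TrivSqZeroExt A C) A := moduleOfFst A C A
    letI : Module (TrivSqZeroExt A C) C := moduleOfFst A C C
    Nonempty ((A →ₗ[TrivSqZeroExt A C] TrivSqZeroExt A C) ≃ₗ[TrivSqZeroExt A C] C) ∧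
      ∀ i : ℕ, 1 ≤ i → Subsingleton (ExtGroup (TrivSqZeroExt A C) i A (TrivSqZeroExt A C)) := by
  let : Module (TrivSqZeroExt A C) A := moduleOfFst A C A
  let : Module (TrivSqZeroExt A C) C := moduleOfFst A C C
  obtain ⟨_, hbij, hExt⟩ := hC
  have smulA : ∀ (r : TrivSqZeroExt A C) (a : A), r • a = r.fst * a := fun _ _ ↦ rfl
  have smulC : ∀ (r : TrivSqZeroExt A C) (c : C), r • c = r.fst • c := fun _ _ ↦ rfl
  have hfst (χ : A →ₗ[TrivSqZeroExt A C] TrivSqZeroExt A C) : (χ 1).fst = 0 := by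
    apply hbij.1
    ext c
    have := congrArg snd (χ.map_smul (inr c) 1)
    simpa [smulA] using this.symm
  refine ⟨⟨LinearEquiv.ofBijective
    { toFun := fun φ ↦ (φ 1).snd
      map_add' := fun _ _ ↦ rfl
      map_smul' := ?_ } ⟨?_, ?_⟩⟩, ?_⟩
  · intro r φ
    simp [smulC, hfst]
  · intro φ ψ h
    ext a : 1
    have ha : a = (inl a : TrivSqZeroExt A C) • (1 : A) := by simp [smulA]
    rw [ha, map_smul, map_smul]
    congr 1
    exact TrivSqZeroExt.ext ((hfst φ).trans (hfst ψ).symm) h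
  · intro c
    refine ⟨{ toFun := fun a ↦ inr (a • c), map_add' := ?_, map_smul' := ?_ }, ?_⟩
    · intro a b
      rw [add_smul, inr_add]
    · intro r a
      ext <;> simp [smulA, mul_smul, smul_comm a]
    · exact one_smul A c
  · rintro (_ | n) hn
    · omega
    rw [subsingleton_extGroup_succ_iff]
    have : Module.Finite (TrivSqZeroExt A C) A :=
      .of_surjective (LinearMap.toSpanSingleton (TrivSqZeroExt A C) A 1) fun a ↦
        ⟨inl a, by simp [smulA]⟩
    refine subsingleton_ext_of_restrictInl hbij
      (fun k ↦ (subsingleton_extGroup_succ_iff C C k).1 (hExt _ (Nat.le_add_left 1 k)))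
      n _ fun k ↦ ?_
    have : Projective ((restrictInl A C).obj (ModuleCat.of (TrivSqZeroExt A C) A)) := by
      let e : A ≃ₗ[A] (restrictInl A C).obj (ModuleCat.of (TrivSqZeroExt A C) A) :=
        { AddEquiv.refl A with map_smul' := fun _ _ ↦ rfl }
      exact Projective.of_iso e.toModuleIso (inferInstanceAs (Projective (ModuleCat.of A A)))
    exact Abelian.Ext.subsingleton_of_projective _ _ _
end

section
/- Let A be a commutative noetherian ring, let C be a semi-dualizing module for A, and let I be an injective A-module. Then for every (A ⋉ C)-module N and every i ≥ 0, there is an isomorphism of abelian groups Ext^i_{A ⋉ C}(Hom_A(A ⋉ C, I), N) ≅ Ext^i_A(Hom_A(C, I), N), where on the right-hand side N is viewed as an A-module via the inclusion A → A ⋉ C. -/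
open TrivSqZeroExt

universe u

section

open CategoryTheory TensorProduct

section TensorEvaluation

variable (R : Type u) [CommRing R] (M C I : Type u) [AddCommGroup M] [Module R M]
  [AddCommGroup C] [Module R C] [AddCommGroup I] [Module R I]

/-- The tensor evaluation map `M ⊗ Hom(C, I) → Hom(Hom(M, C), I)`. -/
noncomputable def tensorEvaluation : M ⊗[R] (C →ₗ[R] I) →ₗ[R] ((M →ₗ[R] C) →ₗ[R] I) :=
  TensorProduct.lift ((LinearMap.llcomp R (M →ₗ[R] C) C I).flip ∘ₗ LinearMap.applyₗ)

variable {R M C I}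

@[simp]
lemma tensorEvaluation_tmul_apply (m : M) (j : C →ₗ[R] I) (φ : M →ₗ[R] C) :
    tensorEvaluation R M C I (m ⊗ₜ j) φ = j (φ m) := rfl

lemma tensorEvaluation_naturality {M' : Type u} [AddCommGroup M'] [Module R M']
    (f : M →ₗ[R] M') :
    (tensorEvaluation R M' C I) ∘ₗ f.rTensor (C →ₗ[R] I) =
      (LinearMap.lcomp R I (LinearMap.lcomp R C f)) ∘ₗ tensorEvaluation R M C I := by
  ext; rfl

lemma Module.Injective.lcomp_surjective (hI : Module.Injective R I) {X Y : Type u}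
    [AddCommGroup X] [Module R X] [AddCommGroup Y] [Module R Y] (f : X →ₗ[R] Y)
    (hf : Function.Injective f) : Function.Surjective (LinearMap.lcomp R I f) := fun g => by
  obtain ⟨h, hh⟩ := hI.out f hf g
  exact ⟨h, LinearMap.ext hh⟩

lemma Module.Injective.lcomp_exact (hI : Module.Injective R I) {X Y Z : Type u}
    [AddCommGroup X] [Module R X] [AddCommGroup Y] [Module R Y] [AddCommGroup Z] [Module R Z]
    (f : X →ₗ[R] Y) (g : Y →ₗ[R] Z) (hfg : Function.Exact f g) :
    Function.Exact (LinearMap.lcomp R I g) (LinearMap.lcomp R I f) := by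
  intro φ
  constructor
  · intro h
    have hle : LinearMap.ker g ≤ LinearMap.ker φ := by
      intro y hy
      obtain ⟨x, rfl⟩ := (hfg y).1 hy
      exact LinearMap.congr_fun h x
    let φ' : LinearMap.range g →ₗ[R] I :=
      (LinearMap.ker g).liftQ φ hle ∘ₗ g.quotKerEquivRange.symm.toLinearMap
    obtain ⟨ψ, hψ⟩ := hI.lcomp_surjective (LinearMap.range g).subtype
      (Submodule.subtype_injective _) φ'
    refine ⟨ψ, LinearMap.ext fun y => ?_⟩
    have := LinearMap.congr_fun hψ ⟨g y, y, rfl⟩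
    have h2 : g.quotKerEquivRange.symm ⟨g y, y, rfl⟩ = Submodule.Quotient.mk y := by
      rw [LinearEquiv.symm_apply_eq]; rfl
    simpa [φ', h2] using this
  · rintro ⟨ψ, rfl⟩
    ext x
    simp [hfg.apply_apply_eq_zero]

lemma tensorEvaluation_bijective_pi (n : ℕ) :
    Function.Bijective (tensorEvaluation R (Fin n → R) C I) := by
  let e₁ := TensorProduct.piScalarRight R R (C →ₗ[R] I) (Fin n)
  let e := (TensorProduct.comm R _ _ ≪≫ₗ e₁ ≪≫ₗ
    LinearMap.lsum R (fun _ : Fin n => C) R (M := I)) ≪≫ₗ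
    LinearEquiv.congrLeft I R (LinearEquiv.piCongrRight
      (fun _ : Fin n => LinearMap.ringLmapEquivSelf R R C)).symm ≪≫ₗ
    LinearEquiv.congrLeft I R (LinearMap.lsum R (fun _ : Fin n => R) R (M := C))
  have : tensorEvaluation R (Fin n → R) C I = e.toLinearMap := by
    ext i j φ
    simp [e, e₁, LinearEquiv.congrLeft]
  rw [this]
  exact e.bijective

lemma tensorEvaluation_surjective [Module.Finite R M] (hI : Module.Injective R I) :
    Function.Surjective (tensorEvaluation R M C I) := by
  obtain ⟨n, g, hg⟩ := Module.Finite.exists_fin' R M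
  have h := (hI.lcomp_surjective (LinearMap.lcomp R C g)
    (LinearMap.lcomp_injective_of_surjective g hg)).comp
    (tensorEvaluation_bijective_pi (C := C) (I := I) (R := R) n).2
  rw [← LinearMap.coe_comp, ← tensorEvaluation_naturality, LinearMap.coe_comp] at h
  exact h.of_comp

lemma tensorEvaluation_bijective [IsNoetherianRing R] [Module.Finite R M]
    (hI : Module.Injective R I) : Function.Bijective (tensorEvaluation R M C I) := by
  obtain ⟨n, g, hg⟩ := Module.Finite.exists_fin' R M
  have hex : Function.Exact (LinearMap.ker g).subtype g := LinearMap.exact_subtype_ker_map g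
  have hC : Function.Exact (LinearMap.lcomp R C g)
      (LinearMap.lcomp R C (LinearMap.ker g).subtype) :=
    LinearMap.exact_lcomp_of_exact_of_surjective C hex hg
  exact LinearMap.bijective_of_surjective_of_bijective_of_right_exact _ _ _ _
    (tensorEvaluation R (LinearMap.ker g) C I)
    (tensorEvaluation R (Fin n → R) C I) (tensorEvaluation R M C I)
    (tensorEvaluation_naturality _).symm (tensorEvaluation_naturality _).symm
    (rTensor_exact _ hex hg) (hI.lcomp_exact _ _ hC)
    (tensorEvaluation_surjective hI) (tensorEvaluation_bijective_pi n)
    (LinearMap.rTensor_surjective _ hg)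
    (hI.lcomp_surjective _ (LinearMap.lcomp_injective_of_surjective g hg))

end TensorEvaluation

section TorAcyclic

variable {R : Type u} [CommRing R]

/-- All higher `Ext` groups from `M` to `C` vanish. -/
def ExtAcyclic (R : Type u) [CommRing R] (M C : Type u) [AddCommGroup M] [Module R M]
    [AddCommGroup C] [Module R C] : Prop :=
  ∀ i : ℕ, Subsingleton (Abelian.Ext.{u} (ModuleCat.of R M) (ModuleCat.of R C) (i + 1))

/-- Tensoring with `N` preserves the injectivity of the syzygies of finitely generated modules
without higher `Ext` into `C`; a form of `Tor₁`-vanishing. -/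
def SyzygyFlat (R : Type u) [CommRing R] (C N : Type u) [AddCommGroup C] [Module R C]
    [AddCommGroup N] [Module R N] : Prop :=
  ∀ (M : Type u) [AddCommGroup M] [Module R M], Module.Finite R M → ExtAcyclic R M C →
    ∀ (n : ℕ) (g : (Fin n → R) →ₗ[R] M), Function.Surjective g →
      Function.Injective ((LinearMap.ker g).subtype.rTensor N)

variable {M C : Type u} [AddCommGroup M] [Module R M] [AddCommGroup C] [Module R C]

lemma ExtAcyclic.ker (h : ExtAcyclic R M C) {n : ℕ} (g : (Fin n → R) →ₗ[R] M)
    (hg : Function.Surjective g) : ExtAcyclic R (LinearMap.ker g) C := by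
  intro i
  have := h (i + 1)
  have S := LinearMap.shortExact_shortComplexKer hg
  refine subsingleton_of_forall_eq 0 fun x => ?_
  have : Projective (ModuleCat.of R (Fin n → R)) := inferInstance
  obtain ⟨y, rfl⟩ := Abelian.Ext.contravariant_sequence_exact₁ S _ x (add_comm 1 (i + 1))
    (Subsingleton.elim (α := Abelian.Ext.{u} (ModuleCat.of R M) (ModuleCat.of R C) (i + 1 + 1)) _ _)
  have hy : y = 0 := Abelian.Ext.eq_zero_of_projective (P := ModuleCat.of R (Fin n → R)) y
  simp [hy]

lemma ExtAcyclic.lcomp_surjective (h : ExtAcyclic R M C) {n : ℕ} (g : (Fin n → R) →ₗ[R] M)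
    (hg : Function.Surjective g) :
    Function.Surjective (LinearMap.lcomp R C (LinearMap.ker g).subtype) := by
  intro φ
  have := h 0
  have S := LinearMap.shortExact_shortComplexKer hg
  obtain ⟨y, hy⟩ := Abelian.Ext.contravariant_sequence_exact₁ S _
    (Abelian.Ext.mk₀ (ModuleCat.ofHom φ)) (add_comm 1 0)
    (Subsingleton.elim (α := Abelian.Ext.{u} (ModuleCat.of R M) (ModuleCat.of R C) (0 + 1)) _ _)
  obtain ⟨ψ, rfl⟩ := (Abelian.Ext.mk₀_bijective _ _).2 y
  rw [Abelian.Ext.mk₀_comp_mk₀] at hy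
  have := (Abelian.Ext.mk₀_bijective _ _).1 hy
  exact ⟨ψ.hom, congrArg ModuleCat.Hom.hom this⟩

lemma syzygyFlat_hom [IsNoetherianRing R] {I : Type u} [AddCommGroup I] [Module R I]
    (hI : Module.Injective R I) : SyzygyFlat R C (C →ₗ[R] I) := by
  intro M _ _ hM h n g hg
  have h1 := (LinearMap.lcomp_injective_of_surjective (S := R) (N := I) _
    (h.lcomp_surjective g hg)).comp
    (tensorEvaluation_bijective (R := R) (M := LinearMap.ker g) (C := C) hI).1
  rw [← LinearMap.coe_comp, ← tensorEvaluation_naturality, LinearMap.coe_comp] at h1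
  exact h1.of_comp

variable {L P N : Type u} [AddCommGroup L] [Module R L] [AddCommGroup P] [Module R P]
  [AddCommGroup N] [Module R N]

lemma SyzygyFlat.lTensor_injective (hN : SyzygyFlat R C N) (l : L →ₗ[R] P) (p : P →ₗ[R] N)
    (hl : Function.Injective l) (hlp : Function.Exact l p) (hp : Function.Surjective p)
    [Module.Finite R M] (hM : ExtAcyclic R M C) : Function.Injective (l.lTensor M) := by
  rw [injective_iff_map_eq_zero]
  intro x hx
  obtain ⟨n, g, hg⟩ := Module.Finite.exists_fin' R M
  have hex : Function.Exact (LinearMap.ker g).subtype g := LinearMap.exact_subtype_ker_map g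
  have comm₁ (y) : g.rTensor P (l.lTensor _ y) = l.lTensor M (g.rTensor L y) := by
    rw [← LinearMap.comp_apply, ← LinearMap.comp_apply, LinearMap.rTensor_comp_lTensor,
      LinearMap.lTensor_comp_rTensor]
  have comm₂ (y) : (LinearMap.ker g).subtype.rTensor P (l.lTensor _ y) =
      l.lTensor _ ((LinearMap.ker g).subtype.rTensor L y) := by
    rw [← LinearMap.comp_apply, ← LinearMap.comp_apply, LinearMap.rTensor_comp_lTensor,
      LinearMap.lTensor_comp_rTensor]
  have comm₃ (y) : (LinearMap.ker g).subtype.rTensor N (p.lTensor _ y) =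
      p.lTensor _ ((LinearMap.ker g).subtype.rTensor P y) := by
    rw [← LinearMap.comp_apply, ← LinearMap.comp_apply, LinearMap.rTensor_comp_lTensor,
      LinearMap.lTensor_comp_rTensor]
  obtain ⟨y, rfl⟩ := LinearMap.rTensor_surjective L hg x
  rw [← comm₁] at hx
  obtain ⟨z, hz⟩ := (rTensor_exact P hex hg _).1 hx
  have hz' : p.lTensor _ z = 0 := by
    apply hN M ‹_› hM n g hg
    rw [comm₃, hz, map_zero]
    exact (lTensor_exact _ hlp hp).apply_apply_eq_zero y
  obtain ⟨w, rfl⟩ := (lTensor_exact _ hlp hp _).1 hz'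
  rw [comm₂] at hz
  rw [← Module.Flat.lTensor_preserves_injective_linearMap (M := Fin n → R) l hl hz]
  exact (rTensor_exact L hex hg).apply_apply_eq_zero w

lemma SyzygyFlat.of_exact [IsNoetherianRing R] (hN : SyzygyFlat R C N) (l : L →ₗ[R] P)
    (p : P →ₗ[R] N) (hl : Function.Injective l) (hlp : Function.Exact l p) (hp : Function.Surjective p)
    [Module.Flat R P] :
    SyzygyFlat R C L := by
  intro M _ _ _ h n g hg
  have h1 := (Module.Flat.rTensor_preserves_injective_linearMap (M := P) _
    (Submodule.subtype_injective (LinearMap.ker g))).comp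
    (hN.lTensor_injective l p hl hlp hp (h.ker g hg))
  rw [← LinearMap.coe_comp, LinearMap.rTensor_comp_lTensor, ← LinearMap.lTensor_comp_rTensor,
    LinearMap.coe_comp] at h1
  exact h1.of_comp

section Augmentation

variable {𝒞 : Type*} [Category* 𝒞] [Abelian 𝒞] {X : 𝒞} (P : ProjectiveResolution X)

/-- The augmentation of a projective resolution of `X`, with `X` itself as its target. -/
noncomputable def augmentation : P.complex.X 0 ⟶ X := P.π.f 0

lemma d_comp_augmentation : P.complex.d 1 0 ≫ augmentation P = 0 := P.complex_d_comp_π_f_zero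

instance : Epi (augmentation P) := inferInstanceAs (Epi (P.π.f 0))

lemma exact_augmentation : (ShortComplex.mk _ _ (d_comp_augmentation P)).Exact := P.exact₀

end Augmentation

lemma function_exact_of_projectiveResolution {X : ModuleCat.{u} R} (P : ProjectiveResolution X)
    (n : ℕ) :
    Function.Exact (P.complex.d (n + 2) (n + 1)).hom (P.complex.d (n + 1) n).hom :=
  (ShortComplex.ShortExact.moduleCat_exact_iff_function_exact _).1 (P.exact_succ n)

lemma exact_subtype_range_rangeRestrict {L N : Type u} [AddCommGroup L] [Module R L]
    [AddCommGroup N] [Module R N] (a : L →ₗ[R] P) (b : P →ₗ[R] N) (hab : Function.Exact a b) :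
    Function.Exact (LinearMap.range a).subtype b.rangeRestrict := by
  intro x
  rw [Subtype.ext_iff]
  simpa using hab x

/-- Every boundary submodule of a projective resolution is a syzygy of a module with the same
`Tor₁`-vanishing property as the resolved module. -/
lemma SyzygyFlat.exists_exact_range [IsNoetherianRing R] {X : ModuleCat.{u} R}
    (P : ProjectiveResolution X) (hX : SyzygyFlat R C X) (n : ℕ) :
    ∃ (N : ModuleCat.{u} R) (p : P.complex.X n →ₗ[R] N), SyzygyFlat R C N ∧
      Function.Exact (LinearMap.range (P.complex.d (n + 1) n).hom).subtype p ∧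
      Function.Surjective p := by
  induction n with
  | zero =>
    refine ⟨X, (augmentation P).hom, hX, fun x => ?_,
      (ModuleCat.epi_iff_surjective _).1 inferInstance⟩
    refine ((ShortComplex.ShortExact.moduleCat_exact_iff_function_exact _).1
      (exact_augmentation P) x).trans ?_
    simp
  | succ n ih =>
    obtain ⟨N, p, hN, hex, hp⟩ := ih
    have : Module.Projective R (P.complex.X n) :=
      (IsProjective.iff_projective _).2 (P.projective n)
    exact ⟨.of R (LinearMap.range (P.complex.d (n + 1) n).hom), _,
      hN.of_exact _ p (Submodule.subtype_injective _) hex hp,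
      exact_subtype_range_rangeRestrict _ _ (function_exact_of_projectiveResolution P n),
      LinearMap.surjective_rangeRestrict _⟩

lemma SyzygyFlat.lTensor_exact_projectiveResolution [IsNoetherianRing R] {X : ModuleCat.{u} R}
    (P : ProjectiveResolution X) (hX : SyzygyFlat R C X)
    [Module.Finite R M] (hM : ExtAcyclic R M C) (n : ℕ) :
    Function.Exact ((P.complex.d (n + 2) (n + 1)).hom.lTensor M)
      ((P.complex.d (n + 1) n).hom.lTensor M) := by
  obtain ⟨N, p, hN, hex, hp⟩ := hX.exists_exact_range P n
  have h₁ : Function.Exact (P.complex.d (n + 2) (n + 1)).hom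
      (P.complex.d (n + 1) n).hom.rangeRestrict := fun x => by
    rw [← function_exact_of_projectiveResolution P n x, Subtype.ext_iff]
    rfl
  have h₂ : Function.Exact _
      ((LinearMap.range (P.complex.d (n + 1) n).hom).subtype.lTensor M ∘ _) :=
    (lTensor_exact M h₁ (LinearMap.surjective_rangeRestrict _)).comp_injective _
    (hN.lTensor_injective _ p (Submodule.subtype_injective _) hex hp hM) (map_zero _)
  rwa [← LinearMap.coe_comp, ← LinearMap.lTensor_comp, LinearMap.rangeRestrict,
    LinearMap.subtype_comp_codRestrict] at h₂

lemma ExtAcyclic.of_subsingleton (M C : ModuleCat.{u} R)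
    (h : ∀ i : ℕ, 1 ≤ i →
      Subsingleton (((Ext R (ModuleCat.{u} R) i).obj (Opposite.op M)).obj C)) :
    ExtAcyclic R M C := by
  intro i
  let P := projectiveResolution M
  have h₁ := h (i + 1) (by lia)
  have h₂ : Limits.IsZero ((P.complex.linearYonedaObj R C).homology (i + 1)) :=
    (ModuleCat.isZero_of_subsingleton _).of_iso (P.isoExt (i + 1) C).symm
  rw [← HomologicalComplex.exactAt_iff_isZero_homology,
    HomologicalComplex.exactAt_iff' _ i (i + 1) (i + 2) (by simp) (by simp),
    ShortComplex.ShortExact.moduleCat_exact_iff_function_exact] at h₂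
  refine subsingleton_of_forall_eq 0 fun x => ?_
  obtain ⟨f, hf, rfl⟩ := P.extMk_surjective x (i + 2) rfl
  rw [P.extMk_eq_zero_iff _ _ _ _ i rfl]
  obtain ⟨g, hg⟩ := (h₂ f).1 hf
  exact ⟨g, hg⟩

end TorAcyclic

section ExtensionOfScalars

/-- The image of a projective resolution under a right exact functor preserving projective objects
is a projective resolution if it is exact in positive degrees. -/
noncomputable def mapProjectiveResolutionOfExactAt {𝒞 𝒟 : Type*} [Category* 𝒞] [Category* 𝒟]
    [Abelian 𝒞] [Abelian 𝒟] (F : 𝒞 ⥤ 𝒟) [F.Additive] [F.PreservesProjectiveObjects]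
    [Limits.PreservesFiniteColimits F] {X : 𝒞} (P : ProjectiveResolution X)
    (h : ∀ n, ((F.mapHomologicalComplex _).obj P.complex).ExactAt (n + 1)) :
    ProjectiveResolution (F.obj X) where
  complex := (F.mapHomologicalComplex _).obj P.complex
  projective n := F.projective_obj_of_projective (P.projective n)
  π := (ChainComplex.toSingle₀Equiv _ _).symm ⟨F.map (augmentation P),
    ((ShortComplex.mk _ _ (d_comp_augmentation P)).map F).zero⟩
  quasiIso := ⟨fun n => by
    cases n
    · rw [ChainComplex.quasiIsoAt₀_iff, ShortComplex.quasiIso_iff_of_zeros']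
      · refine (ShortComplex.exact_and_epi_g_iff_of_iso ?_).2
          ⟨(exact_augmentation P).map_of_epi_of_preservesCokernel F
            (inferInstanceAs (Epi (augmentation P))) inferInstance,
            inferInstanceAs (Epi (F.map (augmentation P)))⟩
        exact ShortComplex.isoMk (Iso.refl _) (Iso.refl _) (Iso.refl _)
          ((Category.id_comp _).trans (Category.comp_id _).symm)
          ((Category.id_comp _).trans ((ChainComplex.toSingle₀Equiv_symm_apply_f_zero
            (C := (F.mapHomologicalComplex _).obj P.complex) (F.map (augmentation P))
            ((ShortComplex.mk _ _ (d_comp_augmentation P)).map F).zero).symm.trans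
              (Category.comp_id _).symm))
      · exact ((F.mapHomologicalComplex (ComplexShape.down ℕ)).obj P.complex).shape 0 0 (by simp)
      all_goals rfl
    · rw [quasiIsoAt_iff_exactAt']
      · apply h
      · apply ChainComplex.exactAt_succ_single_obj⟩

variable {R : Type u} [CommRing R] {S : Type u} [CommRing S]

/-- A degreewise additive isomorphism between cochain complexes of modules over possibly
different rings induces an additive isomorphism in cohomology. -/
noncomputable def homologyAddEquiv (K : CochainComplex (ModuleCat.{u} R) ℕ)
    (L : CochainComplex (ModuleCat.{u} S) ℕ) (e : ∀ n, K.X n ≃+ L.X n)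
    (he : ∀ n x, e (n + 1) (K.d n (n + 1) x) = L.d n (n + 1) (e n x)) (n : ℕ) :
    K.homology n ≃+ L.homology n := by
  let FR := forget₂ (ModuleCat.{u} R) AddCommGrpCat.{u}
  let FS := forget₂ (ModuleCat.{u} S) AddCommGrpCat.{u}
  let iso : (FR.mapHomologicalComplex _).obj K ≅ (FS.mapHomologicalComplex _).obj L :=
    HomologicalComplex.Hom.isoOfComponents (fun n => (e n).toAddCommGrpIso) (by
      rintro i _ rfl
      ext x
      exact (he i x).symm)
  exact ((((K.sc n).mapHomologyIso FR).symm ≪≫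
    HomologicalComplex.homologyMapIso iso n) ≪≫ (L.sc n).mapHomologyIso FS).addCommGroupIsoToAddEquiv

variable (f : R →+* S)

instance : (ModuleCat.extendScalars.{u, u, u} f).PreservesProjectiveObjects where
  projective_obj hX := (ModuleCat.extendRestrictScalarsAdj.{u} f).map_projective _ hX

instance : (ModuleCat.extendScalars.{u, u, u} f).Additive :=
  (ModuleCat.extendRestrictScalarsAdj.{u} f).left_adjoint_additive

/-- If a projective resolution of `X` stays exact after extension of scalars, then the adjunction
between extension and restriction of scalars passes to `Ext` groups. -/
noncomputable def extExtendScalarsAddEquiv {X : ModuleCat.{u} R} (P : ProjectiveResolution X)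
    (h : ∀ n, (((ModuleCat.extendScalars f).mapHomologicalComplex _).obj P.complex).ExactAt (n + 1))
    (N : ModuleCat.{u} S) (i : ℕ) :
    (((Ext S (ModuleCat.{u} S) i).obj (Opposite.op ((ModuleCat.extendScalars f).obj X))).obj N) ≃+
    (((Ext R (ModuleCat.{u} R) i).obj (Opposite.op X)).obj ((ModuleCat.restrictScalars f).obj N)) :=
  ((mapProjectiveResolutionOfExactAt _ P h).isoExt i N).toLinearEquiv.toAddEquiv.trans <|
    (homologyAddEquiv _ _
      (fun n =>
        { (ModuleCat.extendRestrictScalarsAdj.{u} f).homEquiv (P.complex.X n) N with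
          map_add' := fun _ _ => rfl })
      (fun n x =>
        (ModuleCat.extendRestrictScalarsAdj.{u} f).homEquiv_naturality_left
          (P.complex.d (n + 1) n) x) i).trans
    (P.isoExt i ((ModuleCat.restrictScalars f).obj N)).toLinearEquiv.toAddEquiv.symm

lemma extendScalars_exactAt [IsNoetherianRing R] {C : Type u} [AddCommGroup C] [Module R C]
    {X : ModuleCat.{u} R}
    (P : ProjectiveResolution X) (hX : SyzygyFlat R C X)
    (hfin : Module.Finite R ((ModuleCat.restrictScalars f).obj (ModuleCat.of S S)))
    (hS : ExtAcyclic R ((ModuleCat.restrictScalars f).obj (ModuleCat.of S S)) C) (n : ℕ) :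
    (((ModuleCat.extendScalars f).mapHomologicalComplex _).obj P.complex).ExactAt (n + 1) := by
  rw [HomologicalComplex.exactAt_iff' _ (n + 2) (n + 1) n (by simp) (by simp),
    ShortComplex.ShortExact.moduleCat_exact_iff_function_exact]
  exact hX.lTensor_exact_projectiveResolution P hS n

end ExtensionOfScalars

section TrivialExtension

lemma ExtAcyclic.of_ker {R : Type u} [CommRing R] {M Q C : Type u} [AddCommGroup M] [Module R M]
    [AddCommGroup Q] [Module R Q] [AddCommGroup C] [Module R C] {g : M →ₗ[R] Q}
    (hg : Function.Surjective g) (hK : ExtAcyclic R (LinearMap.ker g) C)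
    (hQ : ExtAcyclic R Q C) : ExtAcyclic R M C := by
  intro i
  have := hK i
  have := hQ i
  have S := LinearMap.shortExact_shortComplexKer hg
  refine subsingleton_of_forall_eq 0 fun x => ?_
  obtain ⟨y, rfl⟩ := Abelian.Ext.contravariant_sequence_exact₂ S _ x (Subsingleton.elim
    (α := Abelian.Ext.{u} (ModuleCat.of R (LinearMap.ker g)) (ModuleCat.of R C) (i + 1)) _ _)
  obtain rfl : y = 0 :=
    Subsingleton.elim (α := Abelian.Ext.{u} (ModuleCat.of R Q) (ModuleCat.of R C) (i + 1)) _ _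
  simp

lemma ExtAcyclic.of_projective {R : Type u} [CommRing R] {M C : Type u} [AddCommGroup M]
    [Module R M] [AddCommGroup C] [Module R C] [Module.Projective R M] : ExtAcyclic R M C := by
  intro i
  have : Projective (ModuleCat.of R M) := inferInstance
  exact Abelian.Ext.subsingleton_of_projective _ _ _

lemma ExtAcyclic.of_linearEquiv {R : Type u} [CommRing R] {M M' C : Type u} [AddCommGroup M]
    [Module R M] [AddCommGroup M'] [Module R M'] [AddCommGroup C] [Module R C] (e : M ≃ₗ[R] M')
    (h : ExtAcyclic R M C) : ExtAcyclic R M' C := by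
  intro i
  have := h i
  refine subsingleton_of_forall_eq 0 fun x => ?_
  have h₀ : (Abelian.Ext.mk₀ e.toModuleIso.hom).comp x (zero_add _) = 0 :=
    Subsingleton.elim (α := Abelian.Ext.{u} (ModuleCat.of R M) (ModuleCat.of R C) (i + 1)) _ _
  have h₁ := congrArg
    (fun y => (Abelian.Ext.mk₀ e.toModuleIso.inv).comp y (zero_add _)) h₀
  rw [Abelian.Ext.mk₀_comp_mk₀_assoc, Iso.inv_hom_id] at h₁
  simpa using h₁

/-- An algebra, seen as a module by restriction of scalars along its structure map, is the
algebra with its own module structure. -/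
def restrictScalarsAlgebraEquiv (R S : Type u) [CommRing R] [CommRing S] [Algebra R S] :
    S ≃ₗ[R] (ModuleCat.restrictScalars (algebraMap R S)).obj (ModuleCat.of S S) :=
  { AddEquiv.refl S with map_smul' := fun r s => Algebra.smul_def r s }

/-- An additive equivalence out of an extension of scalars is an isomorphism of modules if it
is linear on pure tensors. -/
noncomputable def extendScalarsIso {R S : Type u} [CommRing R] [CommRing S] [Algebra R S]
    (X : ModuleCat.{u} R) (Y : ModuleCat.{u} S)
    (t : ((ModuleCat.restrictScalars (algebraMap R S)).obj (ModuleCat.of S S)) ⊗[R] X ≃+ Y)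
    (ht : ∀ (b x : S) (j : X), t (restrictScalarsAlgebraEquiv R S (b * x) ⊗ₜ j) =
      b • t (restrictScalarsAlgebraEquiv R S x ⊗ₜ j)) :
    (ModuleCat.extendScalars (algebraMap R S)).obj X ≅ Y :=
  let E := (ModuleCat.extendScalars (algebraMap R S)).obj X
  let e : E ≃ₗ[S] Y :=
    { toFun := t
      invFun := t.symm
      map_add' := map_add t
      left_inv := t.left_inv
      right_inv := t.right_inv
      map_smul' := fun b z => by
        induction z using TensorProduct.induction_on with
        | zero => exact (congrArg t (smul_zero (A := E) b)).trans ((map_zero t).trans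
            ((congrArg (b • ·) (map_zero t)).trans (smul_zero b)).symm)
        | add z w hz hw =>
          exact (congrArg t (smul_add (A := E) b z w)).trans ((map_add t _ _).trans
            ((congrArg₂ (· + ·) hz hw).trans
              ((congrArg (b • ·) (map_add t z w)).trans (smul_add b _ _)).symm))
        | tmul x j => exact ht b x j }
  e.toModuleIso

variable {A C I : Type} [CommRing A] [AddCommGroup C] [Module A C] [AddCommGroup I] [Module A I]

/-- The pairing `(x, y) ↦ (x * y).snd` on a trivial square-zero extension. -/
noncomputable def sndMul : TrivSqZeroExt A C →ₗ[A] TrivSqZeroExt A C →ₗ[A] C :=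
  (LinearMap.mul A (TrivSqZeroExt A C)).compr₂ (sndHom A C)

@[simp]
lemma sndMul_apply (x y : TrivSqZeroExt A C) : sndMul x y = (x * y).snd := rfl

lemma sndMul_bijective (hC : Function.Bijective (LinearMap.lsmul A C)) :
    Function.Bijective (sndMul : TrivSqZeroExt A C →ₗ[A] TrivSqZeroExt A C →ₗ[A] C) := by
  constructor
  · rw [← LinearMap.ker_eq_bot, LinearMap.ker_eq_bot']
    intro x hx
    ext
    · refine (map_eq_zero_iff _ hC.1).1 (LinearMap.ext fun c => ?_)
      simpa using LinearMap.congr_fun hx (inr c)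
    · simpa using LinearMap.congr_fun hx 1
  · intro φ
    obtain ⟨a, ha⟩ := hC.2 (φ ∘ₗ inrHom A C)
    refine ⟨inl a + inr (φ 1), LinearMap.ext fun y => ?_⟩
    have h₁ : a • y.snd = φ (inr y.snd) := LinearMap.congr_fun ha y.snd
    have h₂ : y = y.fst • 1 + inr y.snd := by ext <;> simp
    conv_rhs => rw [h₂, map_add, map_smul, ← h₁]
    simp [add_comm]

lemma finite_trivSqZeroExt [Module.Finite A C] : Module.Finite A (TrivSqZeroExt A C) :=
  inferInstanceAs (Module.Finite A (A × C))

lemma ExtAcyclic.trivSqZeroExt (h : ExtAcyclic A C C) : ExtAcyclic A (TrivSqZeroExt A C) C := by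
  let g : TrivSqZeroExt A C →ₗ[A] A := (fstHom A A C).toLinearMap
  have hg : Function.Surjective g := fun a => ⟨inl a, fst_inl C a⟩
  refine .of_ker hg (.of_linearEquiv (LinearEquiv.ofBijective
    ((inrHom A C).codRestrict (LinearMap.ker g) fun c => fst_inr A c) ⟨fun c d hcd => ?_, ?_⟩) h)
    .of_projective
  · exact inr_injective (congrArg Subtype.val hcd)
  · rintro ⟨x, hx⟩
    exact ⟨x.snd, Subtype.ext (TrivSqZeroExt.ext hx.symm rfl)⟩

/-- Extending the scalars of `Hom(C, I)` to the trivial square-zero extension of `A` by `C`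
gives the coinduced module of `I`. -/
noncomputable def extendScalarsHomIso [IsNoetherianRing A] [Module.Finite A C]
    (hC : Function.Bijective (LinearMap.lsmul A C)) (hI : Module.Injective A I) :
    (ModuleCat.extendScalars (algebraMap A (TrivSqZeroExt A C))).obj
        (ModuleCat.of A (C →ₗ[A] I)) ≅
      ModuleCat.of (TrivSqZeroExt A C) (TrivSqZeroExt A C →ₗ[A] I) :=
  let e := restrictScalarsAlgebraEquiv A (TrivSqZeroExt A C)
  have := finite_trivSqZeroExt (A := A) (C := C)
  have := Module.Finite.equiv e
  let M := (ModuleCat.restrictScalars (algebraMap A (TrivSqZeroExt A C))).obj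
    (ModuleCat.of _ (TrivSqZeroExt A C))
  let t := (LinearEquiv.ofBijective _ (tensorEvaluation_bijective (M := M) (C := C) hI)).trans
    (LinearEquiv.arrowCongr ((LinearEquiv.arrowCongr e.symm (LinearEquiv.refl A C)).trans
      (LinearEquiv.ofBijective _ (sndMul_bijective hC)).symm) (LinearEquiv.refl A I))
  have ht (x y : TrivSqZeroExt A C) (j : C →ₗ[A] I) : t (e x ⊗ₜ j) y = j (y * x).snd := rfl
  extendScalarsIso _ _ t.toAddEquiv fun b x j => by
    refine LinearMap.ext fun y => ?_
    refine (ht (b * x) y j).trans (Eq.trans ?_ (ht x (b * y) j).symm)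
    rw [mul_left_comm, mul_assoc]

end TrivialExtension

end

/-- If `A` is a commutative noetherian ring, `C` a semi-dualizing `A`-module
and `I` an injective `A`-module, then for every `(A ⋉ C)`-module `N` and every `i ≥ 0` there
is an isomorphism of abelian groups
`Ext^i_{A ⋉ C}(Hom_A(A ⋉ C, I), N) ≅ Ext^i_A(Hom_A(C, I), N)`,
where on the right-hand side `N` is viewed as an `A`-module via the inclusion `A → A ⋉ C`. -/
theorem ext_hom_trivSqZeroExt_iso
    (A : Type) [CommRing A] [IsNoetherianRing A] (C : Type) [AddCommGroup C] [Module A C]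
    (hC : IsSemidualizing A C)
    (I : Type) [AddCommGroup I] [Module A I] (hI : Module.Injective A I)
    (N : Type) [AddCommGroup N] [Module (TrivSqZeroExt A C) N] (i : ℕ) :
    letI : Module A N := Module.compHom N (algebraMap A (TrivSqZeroExt A C))
    Nonempty (ExtGroup (TrivSqZeroExt A C) i (TrivSqZeroExt A C →ₗ[A] I) N ≃+
      ExtGroup A i (C →ₗ[A] I) N) := by
  obtain ⟨hfin, hbij, hext⟩ := hC
  let f := algebraMap A (TrivSqZeroExt A C)
  let e := restrictScalarsAlgebraEquiv A (TrivSqZeroExt A C)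
  have := finite_trivSqZeroExt (A := A) (C := C)
  let P := CategoryTheory.projectiveResolution (ModuleCat.of A (C →ₗ[A] I))
  have hP := extendScalars_exactAt f P (syzygyFlat_hom (C := C) hI) (Module.Finite.equiv e)
    (.of_linearEquiv e (ExtAcyclic.of_subsingleton (.of A C) (.of A C) hext).trivSqZeroExt)
  exact ⟨((((Ext _ (ModuleCat (TrivSqZeroExt A C)) i).mapIso (extendScalarsHomIso hbij hI).op).app
    (ModuleCat.of _ N)).toLinearEquiv.toAddEquiv).trans (extExtendScalarsAddEquiv f P hP _ i)⟩
end

section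
/- Let A be a commutative noetherian ring, let C and M be A-modules, and let I be an injective A-module. Then for every i ≥ 0 there is an isomorphism of abelian groups Ext^i_A(M, Hom_A(C, I)) ≅ Ext^i_A(C, Hom_A(M, I)). -/
open CategoryTheory

universe u

/-- Two surjections with corresponding kernels have isomorphic targets. -/
lemma nonempty_addEquiv_of_surjective {G H A B : Type*} [AddCommGroup G] [AddCommGroup H]
    [AddCommGroup A] [AddCommGroup B] (e : G ≃+ H) (φ : G →+ A) (ψ : H →+ B)
    (hφ : Function.Surjective φ) (hψ : Function.Surjective ψ)
    (h : ∀ g, φ g = 0 ↔ ψ (e g) = 0) : Nonempty (A ≃+ B) := by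
  have hker : φ.ker = (ψ.comp (e : G →+ H)).ker := AddSubgroup.ext h
  exact ⟨((QuotientAddGroup.quotientKerEquivOfSurjective φ hφ).symm.trans
    (QuotientAddGroup.quotientAddEquivOfEq hker)).trans
      (QuotientAddGroup.quotientKerEquivOfSurjective (ψ.comp (e : G →+ H))
        (hψ.comp e.surjective))⟩

open Abelian CochainComplex HomComplex in
lemma CategoryTheory.ProjectiveResolution.extMk_eq_zero_iff_prev
    {C : Type*} [Category* C] [Abelian C] [HasExt C] {X : C}
    (P : ProjectiveResolution X) {Y : C} {n : ℕ} (f : P.complex.X n ⟶ Y) (m : ℕ) (hm : n + 1 = m)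
    (hf : P.complex.d m n ≫ f = 0) :
    P.extMk f m hm hf = 0 ↔
      ∃ g : P.complex.X ((ComplexShape.up ℕ).prev n) ⟶ Y,
        P.complex.d n ((ComplexShape.up ℕ).prev n) ≫ g = f := by
  cases n with
  | succ p => exact P.extMk_eq_zero_iff f m hm hf ((ComplexShape.up ℕ).prev (p + 1)) (by simp)
  | zero =>
    rw [← P.extEquivCohomologyClass.apply_eq_iff_eq,
      P.extEquivCohomologyClass_extMk, P.extEquivCohomologyClass_zero,
      CohomologyClass.mk_eq_zero_iff,
      Cocycle.toSingleMk_mem_coboundaries_iff _ _ _ _ _ 1 (by lia)]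
    have hz : Limits.IsZero (P.cochainComplex.X 1) :=
      CochainComplex.isZero_of_isStrictlyLE _ 0 _
    have hd : P.complex.d 0 ((ComplexShape.up ℕ).prev 0) = 0 := P.complex.shape _ _ (by simp)
    simp only [hz.eq_of_tgt _ (0 : P.cochainComplex.X (-((0 : ℕ) : ℤ)) ⟶ _), hd,
      Limits.zero_comp, exists_const]
    constructor
    · intro h
      exact (cancel_epi (P.cochainComplexXIso (-((0 : ℕ) : ℤ)) 0 rfl).hom).1
        (by rw [Limits.comp_zero, h])
    · rintro rfl
      simp

/-- The `Ext` groups obtained by deriving `Hom` in the first variable agree with the morphism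
groups in the derived category. -/
lemma ModuleCat.nonempty_ext_addEquiv {R : Type u} [CommRing R] (X Y : ModuleCat.{u} R) (n : ℕ) :
    Nonempty (((Ext R (ModuleCat R) n).obj (Opposite.op X)).obj Y ≃+ Abelian.Ext X Y n) := by
  let P := ProjectiveResolution.of X
  let S := (P.complex.linearYonedaObj R Y).sc n
  let e : S.moduleCatLeftHomologyData.H ≅ ((Ext R (ModuleCat R) n).obj (Opposite.op X)).obj Y :=
    (P.isoExt n Y ≪≫ S.moduleCatHomologyIso).symm
  have hm : n + 1 = (ComplexShape.up ℕ).next n := by simp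
  let φ : LinearMap.ker S.g.hom →+ S.moduleCatLeftHomologyData.H :=
    S.moduleCatLeftHomologyData.π.hom.toAddMonoidHom
  let ψ : LinearMap.ker S.g.hom →+ Abelian.Ext X Y n :=
    AddMonoidHom.mk' (fun f ↦ P.extMk (Y := Y) f.1 _ hm f.2)
      (fun f g ↦ (P.add_extMk (Y := Y) f.1 g.1 _ hm f.2 g.2).symm)
  obtain ⟨e'⟩ := nonempty_addEquiv_of_surjective (AddEquiv.refl _) φ ψ
    (Submodule.mkQ_surjective _)
    (fun α ↦ by
      obtain ⟨f, hf, rfl⟩ := P.extMk_surjective α _ hm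
      exact ⟨⟨f, hf⟩, rfl⟩)
    (fun f ↦ by
      refine ((Submodule.Quotient.mk_eq_zero _).trans ?_).trans
        (P.extMk_eq_zero_iff_prev (Y := Y) f.1 _ hm f.2).symm
      exact exists_congr fun g ↦ Subtype.ext_iff)
  exact ⟨e.toLinearEquiv.toAddEquiv.symm.trans e'⟩

section Hom

variable {A : Type u} [CommRing A]

/-- `Hom(P, I)` is injective for `P` flat and `I` injective. -/
lemma Module.Injective.linearMap_of_flat (P I : Type u) [AddCommGroup P] [Module A P]
    [AddCommGroup I] [Module A I] [Module.Flat A P] [Module.Injective A I] :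
    Module.Injective A (P →ₗ[A] I) where
  out X Y _ _ _ _ f hf g := by
    obtain ⟨h, hh⟩ := Module.Injective.out (f.rTensor P)
      (Module.Flat.rTensor_preserves_injective_linearMap f hf) (TensorProduct.lift g)
    refine ⟨TensorProduct.curry h, fun x ↦ LinearMap.ext fun p ↦ ?_⟩
    simpa using hh (x ⊗ₜ p)

/-- The short complex obtained by applying `Hom(-, I)` to a short complex of modules. -/
abbrev CategoryTheory.ShortComplex.linearMapInto (S : ShortComplex (ModuleCat.{u} A)) (I : Type u)
    [AddCommGroup I] [Module A I] : ShortComplex (ModuleCat.{u} A) where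
  X₁ := ModuleCat.of A (S.X₃ →ₗ[A] I)
  X₂ := ModuleCat.of A (S.X₂ →ₗ[A] I)
  X₃ := ModuleCat.of A (S.X₁ →ₗ[A] I)
  f := ModuleCat.ofHom (LinearMap.lcomp A I S.g.hom)
  g := ModuleCat.ofHom (LinearMap.lcomp A I S.f.hom)
  zero := by
    ext h x
    simp

lemma CategoryTheory.ShortComplex.ShortExact.linearMapInto {S : ShortComplex (ModuleCat.{u} A)}
    (hS : S.ShortExact) (I : Type u) [AddCommGroup I] [Module A I] [Module.Injective A I] :
    (S.linearMapInto I).ShortExact := by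
  refine ModuleCat.shortComplex_shortExact _ ?_ ?_ ?_
  · exact LinearMap.exact_lcomp_of_exact_of_surjective I
      ((ShortComplex.ShortExact.moduleCat_exact_iff_function_exact _).1 hS.exact)
      hS.moduleCat_surjective_g
  · exact LinearMap.lcomp_injective_of_surjective _ hS.moduleCat_surjective_g
  · intro g
    obtain ⟨h, hh⟩ := Module.Injective.out S.f.hom hS.moduleCat_injective_f g
    exact ⟨h, LinearMap.ext hh⟩

/-- Swapping the arguments of bilinear maps, as an isomorphism between `Ext`-groups in degree
zero. -/
noncomputable def ModuleCat.extZeroSwap (M C I : Type u) [AddCommGroup M] [Module A M]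
    [AddCommGroup C] [Module A C] [AddCommGroup I] [Module A I] :
    Abelian.Ext (of A M) (of A (C →ₗ[A] I)) 0 ≃+ Abelian.Ext (of A C) (of A (M →ₗ[A] I)) 0 :=
  Abelian.Ext.addEquiv₀.trans <| homAddEquiv.trans <|
    (LinearMap.lflip (R₀ := A)).toAddEquiv.trans <|
    (homAddEquiv (M := of A C) (N := of A (M →ₗ[A] I))).symm.trans Abelian.Ext.addEquiv₀.symm

lemma ModuleCat.extZeroSwap_mk₀_comp (M N : ModuleCat.{u} A) (C I : Type u)
    [AddCommGroup C] [Module A C] [AddCommGroup I] [Module A I] (f : M ⟶ N)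
    (x : Abelian.Ext N (of A (C →ₗ[A] I)) 0) :
    extZeroSwap M C I ((Abelian.Ext.mk₀ f).comp x (zero_add 0)) =
      (extZeroSwap N C I x).comp
        (Abelian.Ext.mk₀ (ofHom (LinearMap.lcomp A I f.hom))) (add_zero 0) := by
  obtain ⟨x, rfl⟩ := Abelian.Ext.addEquiv₀.symm.surjective x
  have h {X Y : ModuleCat.{u} A} (y : X ⟶ Y) :
      Abelian.Ext.addEquiv₀ (Abelian.Ext.mk₀ y) = y :=
    Abelian.Ext.addEquiv₀.apply_symm_apply y
  simp only [extZeroSwap, AddEquiv.trans_apply, Abelian.Ext.addEquiv₀_symm_apply,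
    Abelian.Ext.mk₀_comp_mk₀, h]
  rfl

open Abelian in
lemma ModuleCat.nonempty_ext_linearMap_addEquiv (I : Type u) [AddCommGroup I] [Module A I]
    [Module.Injective A I] (n : ℕ) (M C : ModuleCat.{u} A) :
    Nonempty (Ext M (of A (C →ₗ[A] I)) n ≃+ Ext C (of A (M →ₗ[A] I)) n) := by
  induction n generalizing M with
  | zero => exact ⟨extZeroSwap M C I⟩
  | succ n ih =>
    let S := M.projectiveShortComplex
    have hS : S.ShortExact := M.shortExact_projectiveShortComplex
    have hT := hS.linearMapInto I
    have : Projective S.X₂ := ModuleCat.projective_of_free (Module.Free.chooseBasis A S.X₂)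
    have : Module.Injective A (S.X₂ →ₗ[A] I) := .linearMap_of_flat _ _
    have : Injective (S.linearMapInto I).X₂ :=
      Module.injective_object_of_injective_module A (S.X₂ →ₗ[A] I)
    have hφ := precomp_extClass_surjective_of_projective_X₂ (of A (C →ₗ[A] I)) hS n
    have hψ := postcomp_extClass_surjective_of_projective_X₂ hT C n
    cases n with
    | zero =>
      refine nonempty_addEquiv_of_surjective (extZeroSwap S.X₁ C I) _ _ hφ hψ
        fun g ↦ ⟨fun h ↦ ?_, fun h ↦ ?_⟩
      · obtain ⟨x, rfl⟩ := Ext.contravariant_sequence_exact₁ hS _ g (add_comm 1 0) h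
        rw [extZeroSwap_mk₀_comp]
        refine (Ext.comp_assoc (extZeroSwap S.X₂ C I x) (Ext.mk₀ (S.linearMapInto I).g)
          hT.extClass (add_zero 0) (zero_add 1) (zero_add 1)).trans ?_
        rw [ShortComplex.ShortExact.comp_extClass, Ext.comp_zero]
      · obtain ⟨x, hx⟩ := Ext.covariant_sequence_exact₃ C hT _ rfl h
        obtain ⟨x, rfl⟩ := (extZeroSwap S.X₂ C I).surjective x
        obtain rfl := (extZeroSwap S.X₁ C I).injective
          ((extZeroSwap_mk₀_comp _ _ C I S.f x).trans hx)
        simp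
    | succ n =>
      obtain ⟨e⟩ := ih S.X₁
      refine nonempty_addEquiv_of_surjective e _ _ hφ hψ fun g ↦ ?_
      have h₁ : hS.extClass.precomp _ (add_comm 1 (n + 1)) g = 0 → g = 0 := fun h ↦ by
        obtain ⟨x, rfl⟩ := Ext.contravariant_sequence_exact₁ hS _ g (add_comm 1 (n + 1)) h
        simp [Ext.eq_zero_of_projective x]
      have h₂ : hT.extClass.postcomp C (rfl : n + 1 + 1 = n + 1 + 1) (e g) = 0 →
          e g = 0 := fun h ↦ by
        obtain ⟨x, hx⟩ := Ext.covariant_sequence_exact₃ C hT (e g) rfl h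
        rw [← hx, Ext.eq_zero_of_injective x, Ext.zero_comp]
      refine ⟨fun h ↦ ?_, fun h ↦ ?_⟩
      · rw [h₁ h, map_zero, map_zero]
      · rw [e.map_eq_zero_iff.1 (h₂ h), map_zero]

end Hom

/-- Let `A` be a commutative noetherian ring, `C` and `M` `A`-modules, and
`I` an injective `A`-module.  Then for every `i ≥ 0` there is an isomorphism of abelian
groups `Ext^i_A(M, Hom_A(C, I)) ≅ Ext^i_A(C, Hom_A(M, I))`. -/
theorem ext_hom_swap
    (A : Type) [CommRing A] [IsNoetherianRing A]
    (C : Type) [AddCommGroup C] [Module A C]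
    (M : Type) [AddCommGroup M] [Module A M]
    (I : Type) [AddCommGroup I] [Module A I] (hI : Module.Injective A I) (i : ℕ) :
    Nonempty (ExtGroup A i M (C →ₗ[A] I) ≃+ ExtGroup A i C (M →ₗ[A] I)) := by
  obtain ⟨e₁⟩ := ModuleCat.nonempty_ext_addEquiv (.of A M) (.of A (C →ₗ[A] I)) i
  obtain ⟨e₂⟩ := ModuleCat.nonempty_ext_linearMap_addEquiv I i (.of A M) (.of A C)
  obtain ⟨e₃⟩ := ModuleCat.nonempty_ext_addEquiv (.of A C) (.of A (M →ₗ[A] I)) i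
  exact ⟨(e₁.trans e₂).trans e₃.symm⟩
end

section
/- Let R be a commutative noetherian local ring with maximal ideal m and residue field k = R/m, let E be an injective hull of k over R (an injective R-module containing k as an essential submodule), and let R̂ denote the m-adic completion of R. Then for every i ≥ 0 there is an isomorphism of R-modules Ext^i_R(E, k) ≅ Ext^i_R(k, R) ⊗_R R̂. -/
theorem Module.Injective.exists_comp_eq {R : Type} [CommRing R] {E : Type} [AddCommGroup E]
    [Module R E] (hE : Module.Injective R E) {X Y : Type} [AddCommGroup X] [Module R X]
    [AddCommGroup Y] [Module R Y] (h : X →ₗ[R] Y) (φ : X →ₗ[R] E)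
    (hφ : LinearMap.ker h ≤ LinearMap.ker φ) : ∃ G : Y →ₗ[R] E, ∀ x, G (h x) = φ x := by
  obtain ⟨G, hG⟩ := hE.out (LinearMap.range h).subtype (Submodule.injective_subtype _)
    ((LinearMap.ker h).liftQ φ hφ ∘ₗ h.quotKerEquivRange.symm.toLinearMap)
  refine ⟨G, fun x => ?_⟩
  have := hG ⟨h x, x, rfl⟩
  have e : h.quotKerEquivRange.symm ⟨h x, x, rfl⟩ = Submodule.Quotient.mk x := by
    rw [LinearEquiv.symm_apply_eq]
    rfl
  simpa [e] using this

section InjectiveHull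

open IsLocalRing

variable {R : Type} [CommRing R] [IsLocalRing R]
  {E : Type} [AddCommGroup E] [Module R E] {ι : ResidueField R →ₗ[R] E}

theorem exists_smul_eq_of_maximalIdeal_smul_eq_zero
    (hess : ∀ N : Submodule R E, N ⊓ LinearMap.range ι = ⊥ → N = ⊥) {x : E}
    (hx : ∀ a ∈ maximalIdeal R, a • x = 0) : ∃ r : R, x = r • ι 1 := by
  by_cases h0 : x = 0
  · exact ⟨0, by simp [h0]⟩
  have h1 : ¬ (Submodule.span R {x} ⊓ LinearMap.range ι = ⊥) := fun h =>
    h0 (by simpa using hess _ h)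
  obtain ⟨y, hy, hy0⟩ := (Submodule.ne_bot_iff _).1 h1
  obtain ⟨hy1, b, rfl⟩ := hy
  obtain ⟨c, hc⟩ := Submodule.mem_span_singleton.1 hy1
  have hcu : IsUnit c := by
    by_contra hcu
    exact hy0 (by rw [← hc, hx c ((mem_maximalIdeal c).2 hcu)])
  obtain ⟨u, rfl⟩ := hcu
  obtain ⟨s, rfl⟩ := residue_surjective b
  have hs : residue R s = s • (1 : ResidueField R) := by
    rw [Algebra.smul_def, mul_one]; rfl
  refine ⟨↑u⁻¹ * s, ?_⟩
  rw [mul_smul, ← map_smul, ← hs, ← hc, smul_smul, Units.inv_mul, one_smul]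

theorem maximalIdeal_smul_residueField {a : R} (ha : a ∈ maximalIdeal R) (b : ResidueField R) :
    a • b = 0 := by
  rw [Algebra.smul_def, ResidueField.algebraMap_eq, (residue_eq_zero_iff a).2 ha, zero_mul]

theorem residueField_dual_equiv (hι : Function.Injective ι)
    (hess : ∀ N : Submodule R E, N ⊓ LinearMap.range ι = ⊥ → N = ⊥) :
    Nonempty (ResidueField R ≃ₗ[R] (ResidueField R →ₗ[R] E)) := by
  refine ⟨LinearEquiv.ofBijective ((LinearMap.mul R (ResidueField R)).compr₂ ι) ⟨?_, ?_⟩⟩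
  · intro a b h
    have := LinearMap.congr_fun h 1
    exact hι (by simpa using this)
  · intro f
    obtain ⟨r, hr⟩ := exists_smul_eq_of_maximalIdeal_smul_eq_zero hess (x := f 1) (fun a ha => by
      rw [← map_smul, maximalIdeal_smul_residueField ha, map_zero])
    refine ⟨r • 1, LinearMap.ext fun b => ?_⟩
    obtain ⟨s, rfl⟩ := residue_surjective b
    have hs : residue R s = s • (1 : ResidueField R) := by
      rw [Algebra.smul_def, mul_one]; rfl
    rw [hs, map_smul f, hr, LinearMap.compr₂_apply, LinearMap.mul_apply', smul_one_mul,
      map_smul, map_smul, smul_comm]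

theorem exists_mem_pow_forall_torsion_succ [IsNoetherianRing R] (hE : Module.Injective R E)
    (hess : ∀ N : Submodule R E, N ⊓ LinearMap.range ι = ⊥ → N = ⊥) (n : ℕ) (φ : E →ₗ[R] E)
    (hφ : ∀ x, (∀ a ∈ maximalIdeal R ^ n, a • x = 0) → φ x = 0) :
    ∃ c : R, ∀ x, (∀ a ∈ maximalIdeal R ^ (n + 1), a • x = 0) → φ x = c • x := by
  obtain ⟨d, a, ha⟩ := Submodule.fg_iff_exists_fin_generating_family.1
    (IsNoetherian.noetherian (maximalIdeal R ^ n))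
  let V := Submodule.torsionBySet R E (maximalIdeal R ^ (n + 1) : Ideal R)
  let h : V →ₗ[R] (Fin d → E) := LinearMap.pi fun j => a j • V.subtype
  obtain ⟨G, hG⟩ := hE.exists_comp_eq h (φ ∘ₗ V.subtype) (fun x hx => by
    have hx' : ∀ j, a j • (x : E) = 0 := fun j => congr_fun (LinearMap.mem_ker.1 hx) j
    refine hφ _ fun b hb => ?_
    have : Submodule.span R (Set.range a) ≤
        LinearMap.ker (LinearMap.toSpanSingleton R E (x : E)) := by
      rw [Submodule.span_le]
      rintro _ ⟨j, rfl⟩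
      simpa using hx' j
    simpa using this (ha ▸ hb))
  have hι0 : ∀ b ∈ maximalIdeal R, b • ι 1 = 0 := fun b hb => by
    rw [← map_smul, maximalIdeal_smul_residueField hb, map_zero]
  have key : ∀ j, ∃ c : R, G (Pi.single j (ι 1)) = c • ι 1 := fun j =>
    exists_smul_eq_of_maximalIdeal_smul_eq_zero hess fun b hb => by
      rw [← map_smul, ← Pi.single_smul, hι0 b hb, Pi.single_zero, map_zero]
  choose c hc using key
  refine ⟨∑ j, c j * a j, fun x hx => ?_⟩
  have hxV : x ∈ V := (Submodule.mem_torsionBySet_iff _ _).2 fun b => hx b b.2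
  have h1 := hG ⟨x, hxV⟩
  have h2 : φ x = G (fun j => a j • x) := h1.symm
  rw [h2, Finset.sum_smul, ← Finset.univ_sum_single (fun j => a j • x), map_sum]
  refine Finset.sum_congr rfl fun j _ => ?_
  obtain ⟨r, hr⟩ := exists_smul_eq_of_maximalIdeal_smul_eq_zero hess (x := a j • x) fun b hb => by
    rw [smul_smul]
    refine hx _ ?_
    rw [pow_succ']
    exact Ideal.mul_mem_mul hb (ha ▸ Submodule.subset_span ⟨j, rfl⟩)
  rw [mul_smul, hr, Pi.single_smul, map_smul, hc, smul_comm]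

theorem exists_forall_torsion_eq_smul [IsNoetherianRing R] (hE : Module.Injective R E)
    (hess : ∀ N : Submodule R E, N ⊓ LinearMap.range ι = ⊥ → N = ⊥) (φ : E →ₗ[R] E) (n : ℕ) :
    ∃ c : R, ∀ x, (∀ a ∈ maximalIdeal R ^ n, a • x = 0) → φ x = c • x := by
  induction n with
  | zero =>
    refine ⟨0, fun x hx => ?_⟩
    have : x = 0 := by simpa using hx 1 (by simp)
    simp [this]
  | succ n ih =>
    obtain ⟨r, hr⟩ := ih
    obtain ⟨c, hc⟩ := exists_mem_pow_forall_torsion_succ hE hess n (φ - r • LinearMap.id)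
      (fun x hx => by simp [hr x hx])
    refine ⟨c + r, fun x hx => ?_⟩
    have := hc x hx
    rw [LinearMap.sub_apply, sub_eq_iff_eq_add] at this
    simpa [add_smul] using this

theorem mem_of_forall_smul_eq_zero (hE : Module.Injective R E)
    (hι : Function.Injective ι) (I : Ideal R) {r : R}
    (hr : ∀ x : E, (∀ a ∈ I, a • x = 0) → r • x = 0) : r ∈ I := by
  by_contra hrI
  obtain ⟨G, hG⟩ := hE.exists_comp_eq
    (LinearMap.toSpanSingleton R (R ⧸ I) (Ideal.Quotient.mk I r))
    (LinearMap.toSpanSingleton R E (ι 1)) (fun a ha => by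
      rw [LinearMap.mem_ker, LinearMap.toSpanSingleton_apply] at ha ⊢
      have ham : a ∈ maximalIdeal R := by
        rw [mem_maximalIdeal]
        rintro ⟨u, rfl⟩
        apply hrI
        rw [← Ideal.Quotient.eq_zero_iff_mem]
        have := congrArg (fun y => (↑u⁻¹ : R) • y) ha
        simpa only [smul_smul, Units.inv_mul, one_smul, smul_zero] using this
      rw [← map_smul, maximalIdeal_smul_residueField ham, map_zero])
  have h1 := hG 1
  simp only [LinearMap.toSpanSingleton_apply, one_smul] at h1
  have hmk : ∀ a : R, Ideal.Quotient.mk I a = a • (1 : R ⧸ I) := fun a => by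
    rw [Algebra.smul_def, mul_one]; rfl
  have h2 : r • G 1 = 0 := hr _ fun a ha => by
    rw [← map_smul, ← hmk, Ideal.Quotient.eq_zero_iff_mem.2 ha, map_zero]
  rw [← map_smul, ← hmk, h1] at h2
  have := hι (h2.trans (map_zero ι).symm)
  exact one_ne_zero this

theorem exists_forall_pow_smul_eq_zero [IsNoetherianRing R]
    (hess : ∀ N : Submodule R E, N ⊓ LinearMap.range ι = ⊥ → N = ⊥) (x : E) :
    ∃ n, ∀ a ∈ maximalIdeal R ^ n, a • x = 0 := by
  let M := Submodule.span R {x}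
  let L : Submodule R M := (LinearMap.range ι).comap M.subtype
  obtain ⟨k, hk⟩ := Ideal.exists_pow_inf_eq_pow_smul (maximalIdeal R) L
  have h1 := hk (k + 1) (Nat.le_succ k)
  have hbot : maximalIdeal R ^ (k + 1) • (⊤ : Submodule R M) ⊓ L = ⊥ := by
    rw [h1, Nat.add_sub_cancel_left, pow_one, eq_bot_iff, Submodule.smul_le]
    rintro a ha y hy
    obtain ⟨b, hb⟩ := (hy.2 : (y : E) ∈ LinearMap.range ι)
    have : a • M.subtype y = 0 := by
      rw [← hb, ← map_smul, maximalIdeal_smul_residueField ha, map_zero]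
    exact Subtype.ext this
  refine ⟨k + 1, fun a ha => ?_⟩
  have h2 : (maximalIdeal R ^ (k + 1) • (⊤ : Submodule R M)).map M.subtype = ⊥ := by
    apply hess
    rw [eq_bot_iff]
    rintro _ ⟨⟨y, hy, rfl⟩, hy2⟩
    have : y ∈ (⊥ : Submodule R M) := hbot ▸ ⟨hy, hy2⟩
    rw [(Submodule.mem_bot R).1 this]
    simp
  have h3 : a • x ∈ (maximalIdeal R ^ (k + 1) • (⊤ : Submodule R M)).map M.subtype :=
    ⟨a • ⟨x, Submodule.mem_span_singleton_self x⟩,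
      Submodule.smul_mem_smul ha Submodule.mem_top, rfl⟩
  simpa [h2] using h3

open Classical in
theorem end_equiv_adicCompletion [IsNoetherianRing R] (hE : Module.Injective R E)
    (hι : Function.Injective ι)
    (hess : ∀ N : Submodule R E, N ⊓ LinearMap.range ι = ⊥ → N = ⊥) :
    Nonempty ((E →ₗ[R] E) ≃ₗ[R] AdicCompletion (maximalIdeal R) R) := by
  set m := maximalIdeal R
  choose c hc using exists_forall_torsion_eq_smul hE hess
  have hmk : ∀ (n : ℕ) (r s : R), (∀ x : E, (∀ a ∈ m ^ n, a • x = 0) → r • x = s • x) →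
      (Submodule.Quotient.mk r : R ⧸ (m ^ n • ⊤ : Submodule R R)) = Submodule.Quotient.mk s :=
    fun n r s h => by
      rw [Submodule.Quotient.eq, smul_eq_mul, Ideal.mul_top]
      refine mem_of_forall_smul_eq_zero hE hι _ fun x hx => ?_
      rw [sub_smul, h x hx, sub_self]
  let f : ∀ n, (E →ₗ[R] E) →ₗ[R] R ⧸ (m ^ n • ⊤ : Submodule R R) := fun n =>
    { toFun := fun φ => Submodule.Quotient.mk (c φ n)
      map_add' := fun φ ψ => by
        rw [← Submodule.Quotient.mk_add]
        refine hmk n _ _ fun x hx => ?_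
        rw [← hc _ n x hx, add_smul, ← hc _ n x hx, ← hc _ n x hx, LinearMap.add_apply]
      map_smul' := fun r φ => by
        rw [RingHom.id_apply, ← Submodule.Quotient.mk_smul]
        refine hmk n _ _ fun x hx => ?_
        rw [← hc _ n x hx, smul_assoc, ← hc _ n x hx, LinearMap.smul_apply] }
  have hle : ∀ {i j : ℕ}, i ≤ j → ∀ x : E, (∀ a ∈ m ^ i, a • x = 0) → ∀ a ∈ m ^ j, a • x = 0 :=
    fun hij x hx a ha => hx a (Ideal.pow_le_pow_right hij ha)
  have hf : ∀ {i j : ℕ} (hij : i ≤ j), AdicCompletion.transitionMap m R hij ∘ₗ f j = f i := by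
    intro i j hij
    refine LinearMap.ext fun φ => hmk i (c φ j) (c φ i) fun x hx => ?_
    rw [← hc _ i x hx, ← hc _ j x (hle hij x hx)]
  refine ⟨LinearEquiv.ofBijective (AdicCompletion.lift m f hf) ⟨?_, ?_⟩⟩
  · rw [injective_iff_map_eq_zero]
    intro φ hφ
    ext x
    obtain ⟨n, hn⟩ := exists_forall_pow_smul_eq_zero hess x
    have h1 : (Submodule.Quotient.mk (c φ n) : R ⧸ (m ^ n • ⊤ : Submodule R R)) = 0 := by
      refine (AdicCompletion.eval_lift_apply m f hf n φ).symm.trans ?_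
      rw [hφ, AdicCompletion.val_zero_apply]
    rw [Submodule.Quotient.mk_eq_zero, smul_eq_mul, Ideal.mul_top] at h1
    rw [hc φ n x hn, hn _ h1, LinearMap.zero_apply]
  · intro a
    choose r hr using fun n => Submodule.Quotient.mk_surjective _ (a.val n)
    have hT := exists_forall_pow_smul_eq_zero hess
    have hcompat : ∀ {i j : ℕ}, i ≤ j → ∀ x : E, (∀ a ∈ m ^ i, a • x = 0) →
        r j • x = r i • x := by
      intro i j hij x hx
      have h1 : AdicCompletion.transitionMap m R hij (a.val j) = a.val i := a.2 hij
      have h2 : (Submodule.Quotient.mk (r j) : R ⧸ (m ^ i • ⊤ : Submodule R R)) =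
          Submodule.Quotient.mk (r i) := by
        rw [hr i, ← h1, ← hr j]
        rfl
      rw [Submodule.Quotient.eq, smul_eq_mul, Ideal.mul_top] at h2
      rw [← sub_eq_zero, ← sub_smul, hx _ h2]
    let N : E → ℕ := fun x => Nat.find (hT x)
    have hN : ∀ n x, (∀ a ∈ m ^ n, a • x = 0) → r (N x) • x = r n • x := fun n x hx =>
      (hcompat (Nat.find_min' (hT x) hx) x (Nat.find_spec (hT x))).symm
    let φ : E →ₗ[R] E :=
      { toFun := fun x => r (N x) • x
        map_add' := fun x y => by
          have hx := hle (le_max_left (N x) (N y)) x (Nat.find_spec (hT x))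
          have hy := hle (le_max_right (N x) (N y)) y (Nat.find_spec (hT y))
          rw [hN _ x hx, hN _ y hy, ← smul_add]
          exact hN _ _ fun a ha => by rw [smul_add, hx a ha, hy a ha, add_zero]
        map_smul' := fun s x => by
          rw [RingHom.id_apply, smul_comm s]
          exact hN _ _ fun a ha => by rw [smul_comm, Nat.find_spec (hT x) a ha, smul_zero] }
    refine ⟨φ, AdicCompletion.ext fun n => ?_⟩
    refine (AdicCompletion.eval_lift_apply m f hf n φ).trans ?_
    rw [← hr n]
    refine hmk n _ _ fun x hx => ?_
    rw [← hc _ n x hx]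
    exact hN n x hx

end InjectiveHull

section DerivedExt

open CategoryTheory Abelian

universe v u

variable {C : Type u} [Category.{v} C] [Abelian C] [HasExt.{v} C] {X Y : C}

theorem CategoryTheory.ProjectiveResolution.extMk_eq_zero_iff_zero (P : ProjectiveResolution X)
    (f : P.complex.X 0 ⟶ Y) (hf : P.complex.d 1 0 ≫ f = 0) :
    P.extMk f 1 rfl hf = 0 ↔ f = 0 := by
  refine ⟨fun h => ?_, fun h => by subst h; simp⟩
  rw [← P.extEquivCohomologyClass.apply_eq_iff_eq, P.extEquivCohomologyClass_extMk,
    P.extEquivCohomologyClass_zero, CochainComplex.HomComplex.CohomologyClass.mk_eq_zero_iff,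
    CochainComplex.HomComplex.Cocycle.toSingleMk_mem_coboundaries_iff _ _ _ _ _ 1 (by simp)] at h
  obtain ⟨g, hg⟩ := h
  have h1 : P.cochainComplex.d (-(0 : ℕ)) 1 ≫ g = 0 := by
    rw [(CochainComplex.isZero_of_isStrictlyLE P.cochainComplex 0 1).eq_of_tgt
      (P.cochainComplex.d _ 1) 0, Limits.zero_comp]
  rw [← cancel_epi (P.cochainComplexXIso (-(0 : ℕ)) 0 rfl).hom, Limits.comp_zero]
  exact hg.symm.trans h1

variable {R : Type} [CommRing R] [Linear R C]

theorem CategoryTheory.ProjectiveResolution.smul_extMk (P : ProjectiveResolution X) {n : ℕ}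
    (f : P.complex.X n ⟶ Y) (m : ℕ) (hm : n + 1 = m) (hf : P.complex.d m n ≫ f = 0) (r : R) :
    r • P.extMk f m hm hf = P.extMk (r • f) m hm (by simp [hf]) := by
  rw [Ext.smul_eq_comp_mk₀, P.extMk_comp_mk₀]
  simp

variable (R) in
/-- A cocycle in `Hom(P, Y)` defines an extension class. -/
noncomputable def CategoryTheory.ProjectiveResolution.extMkLinearMap (P : ProjectiveResolution X)
    (Y : C) (i n : ℕ) :
    LinearMap.ker ((P.complex.linearYonedaObj R Y).sc' i n (n + 1)).g.hom →ₗ[R] Ext X Y n where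
  toFun f := P.extMk f.1 (n + 1) rfl f.2
  map_add' _ _ := (P.add_extMk _ _ _ _ _ _).symm
  map_smul' _ _ := (P.smul_extMk _ _ _ _ _).symm

theorem CategoryTheory.ProjectiveResolution.extMkLinearMap_surjective (P : ProjectiveResolution X)
    (Y : C) (i n : ℕ) : Function.Surjective (P.extMkLinearMap R Y i n) := fun α => by
  obtain ⟨f, hf, h⟩ := P.extMk_surjective α (n + 1) rfl
  exact ⟨⟨f, hf⟩, h⟩

theorem CategoryTheory.ProjectiveResolution.ker_extMkLinearMap (P : ProjectiveResolution X)
    (Y : C) (n : ℕ) : LinearMap.ker (P.extMkLinearMap R Y ((ComplexShape.up ℕ).prev n) n) =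
      LinearMap.range ((P.complex.linearYonedaObj R Y).sc' _ n (n + 1)).moduleCatToCycles := by
  ext ⟨f, hf⟩
  rw [LinearMap.mem_ker]
  cases n with
  | zero =>
    refine (P.extMk_eq_zero_iff_zero f hf).trans ⟨?_, ?_⟩
    · rintro rfl
      exact ⟨0, map_zero _⟩
    · rintro ⟨g, hg⟩
      have h1 : (P.complex.linearYonedaObj R Y).d ((ComplexShape.up ℕ).prev 0) 0 = 0 :=
        HomologicalComplex.shape _ _ _ (by simp)
      refine (congrArg Subtype.val hg).symm.trans ?_
      exact LinearMap.congr_fun (congrArg ModuleCat.Hom.hom h1) g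
  | succ k =>
    have hk : (ComplexShape.up ℕ).prev (k + 1) = k := by simp
    rw [hk]
    refine (P.extMk_eq_zero_iff f (k + 1 + 1) rfl hf k rfl).trans ⟨?_, ?_⟩
    · rintro ⟨g, hg⟩
      exact ⟨g, Subtype.ext hg⟩
    · rintro ⟨g, hg⟩
      exact ⟨g, congrArg Subtype.val hg⟩

theorem ext_linearEquiv_abelianExt [EnoughProjectives C] (X Y : C) (n : ℕ) :
    Nonempty (((Ext R C n).obj (Opposite.op X)).obj Y ≃ₗ[R] Abelian.Ext X Y n) := by
  let P := projectiveResolution X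
  let K := P.complex.linearYonedaObj R Y
  let S := K.sc' ((ComplexShape.up ℕ).prev n) n (n + 1)
  let e : ((Ext R C n).obj (Opposite.op X)).obj Y ≅ S.moduleCatLeftHomologyData.H :=
    P.isoExt n Y ≪≫ ShortComplex.homologyMapIso (K.isoSc' _ n (n + 1) rfl (by simp)) ≪≫
      S.moduleCatHomologyIso
  exact ⟨e.toLinearEquiv ≪≫ₗ Submodule.quotEquivOfEq _ _ (P.ker_extMkLinearMap Y n).symm ≪≫ₗ
    (P.extMkLinearMap R Y _ n).quotKerEquivOfSurjective (P.extMkLinearMap_surjective Y _ n)⟩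

end DerivedExt

section ExtShifting

open CategoryTheory Abelian

variable {R : Type} [CommRing R] {S : ShortComplex (ModuleCat.{0} R)}

theorem exists_covariant_connecting (hS : S.ShortExact) [Injective S.X₂] (X : ModuleCat.{0} R) :
    ∃ δ : (X →ₗ[R] S.X₃) →ₗ[R] Ext X S.X₁ 1, Function.Surjective δ ∧
      ∀ φ, δ φ = 0 ↔ ∃ ψ : X →ₗ[R] S.X₂, S.g.hom ∘ₗ ψ = φ := by
  let e := (Ext.linearEquiv₀ (R := R) (X := X) (Y := S.X₃)).trans ModuleCat.homLinearEquiv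
  have he : ∀ φ, e.symm φ = Ext.mk₀ (ModuleCat.ofHom φ) := fun φ => rfl
  refine ⟨hS.extClass.postcompOfLinear R X (zero_add 1) ∘ₗ e.symm.toLinearMap, ?_, fun φ => ?_⟩
  · intro x
    obtain ⟨y, hy⟩ := Ext.covariant_sequence_exact₁ X hS x (Ext.eq_zero_of_injective _)
      (zero_add 1)
    exact ⟨e y, by simpa using hy⟩
  · change (e.symm φ).comp hS.extClass (zero_add 1) = 0 ↔ _
    rw [he]
    constructor
    · intro h
      obtain ⟨x, hx⟩ := Ext.covariant_sequence_exact₃ X hS _ (zero_add 1) h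
      obtain ⟨ψ, rfl⟩ := Ext.addEquiv₀.symm.surjective x
      refine ⟨ψ.hom, ?_⟩
      rw [Ext.addEquiv₀_symm_apply, Ext.mk₀_comp_mk₀] at hx
      exact congrArg ModuleCat.Hom.hom (Ext.addEquiv₀.symm.injective hx)
    · rintro ⟨ψ, rfl⟩
      have : ModuleCat.ofHom (S.g.hom ∘ₗ ψ) = ModuleCat.ofHom ψ ≫ S.g := rfl
      rw [this, ← Ext.mk₀_comp_mk₀, Ext.comp_assoc_of_second_deg_zero, hS.comp_extClass,
        Ext.comp_zero]

theorem exists_contravariant_connecting (hS : S.ShortExact) [Projective S.X₂]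
    (Y : ModuleCat.{0} R) :
    ∃ δ : (S.X₁ →ₗ[R] Y) →ₗ[R] Ext S.X₃ Y 1, Function.Surjective δ ∧
      ∀ φ, δ φ = 0 ↔ ∃ ψ : S.X₂ →ₗ[R] Y, ψ ∘ₗ S.f.hom = φ := by
  let e := (Ext.linearEquiv₀ (R := R) (X := S.X₁) (Y := Y)).trans ModuleCat.homLinearEquiv
  have he : ∀ φ, e.symm φ = Ext.mk₀ (ModuleCat.ofHom φ) := fun φ => rfl
  refine ⟨hS.extClass.precompOfLinear R Y (add_zero 1) ∘ₗ e.symm.toLinearMap, ?_, fun φ => ?_⟩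
  · intro x
    obtain ⟨y, hy⟩ := Ext.contravariant_sequence_exact₃ hS Y x (Ext.eq_zero_of_projective _)
      (add_zero 1)
    exact ⟨e y, by simpa using hy⟩
  · change hS.extClass.comp (e.symm φ) (add_zero 1) = 0 ↔ _
    rw [he]
    constructor
    · intro h
      obtain ⟨x, hx⟩ := Ext.contravariant_sequence_exact₁ hS Y _ (add_zero 1) h
      obtain ⟨ψ, rfl⟩ := Ext.addEquiv₀.symm.surjective x
      refine ⟨ψ.hom, ?_⟩
      rw [Ext.addEquiv₀_symm_apply, Ext.mk₀_comp_mk₀] at hx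
      exact congrArg ModuleCat.Hom.hom (Ext.addEquiv₀.symm.injective hx)
    · rintro ⟨ψ, rfl⟩
      have : ModuleCat.ofHom (ψ ∘ₗ S.f.hom) = S.f ≫ ModuleCat.ofHom ψ := rfl
      rw [this, ← Ext.mk₀_comp_mk₀, ← Ext.comp_assoc_of_second_deg_zero, hS.extClass_comp,
        Ext.zero_comp]

theorem postcomp_extClass_bijective (hS : S.ShortExact) [Injective S.X₂] (X : ModuleCat.{0} R)
    (n : ℕ) : Function.Bijective
      (hS.extClass.postcompOfLinear R X (rfl : (n + 1) + 1 = n + 1 + 1)) := by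
  refine ⟨?_, postcomp_extClass_surjective_of_projective_X₂ hS X (n + 1)⟩
  rw [injective_iff_map_eq_zero]
  intro x hx
  obtain ⟨y, rfl⟩ := Ext.covariant_sequence_exact₃ X hS x rfl hx
  rw [Ext.eq_zero_of_injective y, Ext.zero_comp]

theorem precomp_extClass_bijective (hS : S.ShortExact) [Projective S.X₂] (Y : ModuleCat.{0} R)
    (n : ℕ) : Function.Bijective
      (hS.extClass.precompOfLinear R Y (add_comm 1 (n + 1))) := by
  refine ⟨?_, precomp_extClass_surjective_of_projective_X₂ Y hS (n + 1)⟩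
  rw [injective_iff_map_eq_zero]
  intro x hx
  obtain ⟨y, rfl⟩ := Ext.contravariant_sequence_exact₁ hS Y x (add_comm 1 (n + 1)) hx
  rw [Ext.eq_zero_of_projective y, Ext.comp_zero]

end ExtShifting

section HomTensor

open TensorProduct

variable (R M S : Type) [CommRing R] [AddCommGroup M] [Module R M] [CommRing S] [Algebra R S]

/-- The natural map `Hom(M, R) ⊗ S → Hom(M, S)`. -/
noncomputable def dualTensorHomAlg : (M →ₗ[R] R) ⊗[R] S →ₗ[R] (M →ₗ[R] S) :=
  (TensorProduct.lid R S).toLinearMap.compRight R ∘ₗ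
    TensorProduct.rTensorHomToHomRTensor (.id R) M R S

variable {R M S}

theorem dualTensorHomAlg_tmul (f : M →ₗ[R] R) (s : S) (m : M) :
    dualTensorHomAlg R M S (f ⊗ₜ s) m = f m • s := by
  simp [dualTensorHomAlg]

theorem dualTensorHomAlg_rTensor_lcomp {N : Type} [AddCommGroup N] [Module R N] (g : N →ₗ[R] M)
    (z : (M →ₗ[R] R) ⊗[R] S) :
    dualTensorHomAlg R N S ((LinearMap.lcomp R R g).rTensor S z) =
      dualTensorHomAlg R M S z ∘ₗ g := by
  induction z with
  | zero => simp
  | add x y hx hy => simp [hx, hy, LinearMap.add_comp]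
  | tmul f s =>
    ext n
    simp [dualTensorHomAlg_tmul]

theorem dualTensorHomAlg_bijective [Module.Flat R S] [Module.FinitePresentation R M] :
    Function.Bijective (dualTensorHomAlg R M S) := by
  let e₁ := TensorProduct.comm R (M →ₗ[R] R) S
  let e₂ := (Module.FinitePresentation.isBaseChange_map R M R S).equiv.restrictScalars R
  let e₃ : (S ⊗[R] M →ₗ[S] S ⊗[R] R) ≃ₗ[R] (S ⊗[R] M →ₗ[S] S) :=
    ((AlgebraTensorModule.rid R S S).congrRight).restrictScalars R
  let e₄ : (S ⊗[R] M →ₗ[S] S) ≃ₗ[R] (M →ₗ[R] S) :=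
    (LinearMap.liftBaseChangeEquiv S).symm.restrictScalars R
  have : dualTensorHomAlg R M S = (e₁ ≪≫ₗ e₂ ≪≫ₗ e₃ ≪≫ₗ e₄).toLinearMap := by
    ext f s m
    have h : (AlgebraTensorModule.rid R S S).congrRight (LinearMap.baseChange S f) (1 ⊗ₜ[R] m) =
        AlgebraTensorModule.rid R S S (LinearMap.baseChange S f (1 ⊗ₜ[R] m)) := rfl
    simp [dualTensorHomAlg_tmul, e₁, e₂, e₃, e₄, h, Algebra.smul_def, mul_comm]
  rw [this]
  exact (e₁ ≪≫ₗ e₂ ≪≫ₗ e₃ ≪≫ₗ e₄).bijective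

end HomTensor

section DimensionShifting

open CategoryTheory TensorProduct

variable {R : Type} [CommRing R]

theorem LinearMap.nonempty_linearEquiv_of_surjective_of_ker {B C B' C' : Type} [AddCommGroup B]
    [Module R B] [AddCommGroup C] [Module R C] [AddCommGroup B'] [Module R B'] [AddCommGroup C']
    [Module R C'] (g : B →ₗ[R] C) (hg : Function.Surjective g) (g' : B' →ₗ[R] C')
    (hg' : Function.Surjective g') (e : B ≃ₗ[R] B') (h : ∀ b, g b = 0 ↔ g' (e b) = 0) :
    Nonempty (C ≃ₗ[R] C') := by
  refine ⟨(g.quotKerEquivOfSurjective hg).symm ≪≫ₗ Submodule.Quotient.equiv _ _ e ?_ ≪≫ₗ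
    g'.quotKerEquivOfSurjective hg'⟩
  ext b
  constructor
  · rintro ⟨x, hx, rfl⟩
    exact (h x).1 hx
  · intro hb
    exact ⟨e.symm b, (h _).2 (by simpa using hb), by simp⟩

theorem Module.Injective.finFunction_dual {E : Type} [AddCommGroup E] [Module R E]
    (hE : Module.Injective R E) (n : ℕ) : Module.Injective R ((Fin n → R) →ₗ[R] E) := by
  rw [← Module.Baer.iff_injective, Module.Baer.congr (LinearEquiv.piRing R E (Fin n) R),
    Module.Baer.iff_injective]
  infer_instance

theorem LinearMap.shortExact_dual {E : Type} [AddCommGroup E] [Module R E]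
    (hE : Module.Injective R E) {F M : Type} [AddCommGroup F] [Module R F] [AddCommGroup M]
    [Module R M] (f : F →ₗ[R] M) (hf : Function.Surjective f) :
    (ShortComplex.mk (ModuleCat.ofHom (LinearMap.lcomp R E f))
      (ModuleCat.ofHom (LinearMap.lcomp R E (LinearMap.ker f).subtype)) (by
        ext φ x
        change φ (f x) = 0
        rw [LinearMap.mem_ker.1 x.2, map_zero])).ShortExact := by
  refine ModuleCat.shortComplex_shortExact _ ?_ ?_ ?_
  · exact LinearMap.exact_lcomp_of_exact_of_surjective E
      (LinearMap.exact_subtype_ker_map f) hf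
  · exact LinearMap.lcomp_injective_of_surjective f hf
  · intro φ
    obtain ⟨G, hG⟩ := hE.out (LinearMap.ker f).subtype (Submodule.injective_subtype _) φ
    exact ⟨G, LinearMap.ext hG⟩

variable {E : Type} [AddCommGroup E] [Module R E] {S : Type} [CommRing S] [Algebra R S]

/-- If `End(E) ≃ S`, then `Hom(E, Hom(M, E)) ≃ Hom(M, S)`. -/
noncomputable def homDualEquiv (e : (E →ₗ[R] E) ≃ₗ[R] S) (M : Type) [AddCommGroup M] [Module R M] :
    (E →ₗ[R] M →ₗ[R] E) ≃ₗ[R] (M →ₗ[R] S) :=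
  LinearMap.lflip ≪≫ₗ e.congrRight

/-- If `End(E) ≃ S` is flat, then `Hom(E, Hom(M, E)) ≃ Hom(M, R) ⊗ S`. -/
noncomputable def homDualEquivTensor [Module.Flat R S] (e : (E →ₗ[R] E) ≃ₗ[R] S) (M : Type)
    [AddCommGroup M] [Module R M] [Module.FinitePresentation R M] :
    (E →ₗ[R] M →ₗ[R] E) ≃ₗ[R] (M →ₗ[R] R) ⊗[R] S :=
  homDualEquiv e M ≪≫ₗ (LinearEquiv.ofBijective _ dualTensorHomAlg_bijective).symm

theorem homDualEquivTensor_lcomp [Module.Flat R S] (e : (E →ₗ[R] E) ≃ₗ[R] S) {M N : Type}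
    [AddCommGroup M] [Module R M] [Module.FinitePresentation R M]
    [AddCommGroup N] [Module R N] [Module.FinitePresentation R N] (g : N →ₗ[R] M)
    (ψ : E →ₗ[R] M →ₗ[R] E) :
    homDualEquivTensor e N (LinearMap.lcomp R E g ∘ₗ ψ) =
      (LinearMap.lcomp R R g).rTensor S (homDualEquivTensor e M ψ) := by
  apply (dualTensorHomAlg_bijective (R := R) (M := N) (S := S)).1
  rw [dualTensorHomAlg_rTensor_lcomp]
  have h : ∀ (M : Type) [AddCommGroup M] [Module R M] [Module.FinitePresentation R M]
      (ψ : E →ₗ[R] M →ₗ[R] E), dualTensorHomAlg R M S (homDualEquivTensor e M ψ) =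
        homDualEquiv e M ψ := fun M _ _ _ ψ =>
    (LinearEquiv.ofBijective _ dualTensorHomAlg_bijective).apply_symm_apply _
  rw [h, h]
  rfl

variable (R) in
/-- `Ext⁰(M, N) ≃ Hom(M, N)`. -/
noncomputable def abelianExtZeroEquiv (M N : Type) [AddCommGroup M] [Module R M] [AddCommGroup N]
    [Module R N] : Abelian.Ext (ModuleCat.of R M) (ModuleCat.of R N) 0 ≃ₗ[R] (M →ₗ[R] N) :=
  (Abelian.Ext.linearEquiv₀ (R := R) (X := ModuleCat.of R M) (Y := ModuleCat.of R N)).trans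
    ModuleCat.homLinearEquiv

theorem abelianExt_dual_equiv_tensor [IsNoetherianRing R] [Module.Flat R S]
    (hE : Module.Injective R E) (e : (E →ₗ[R] E) ≃ₗ[R] S) (i : ℕ) (M : Type) [AddCommGroup M]
    [Module R M] [Module.Finite R M] :
    Nonempty (Abelian.Ext (ModuleCat.of R E) (ModuleCat.of R (M →ₗ[R] E)) i ≃ₗ[R]
      Abelian.Ext (ModuleCat.of R M) (ModuleCat.of R R) i ⊗[R] S) := by
  induction i generalizing M with
  | zero =>
    have : Module.FinitePresentation R M := Module.finitePresentation_of_finite R M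
    exact ⟨abelianExtZeroEquiv R E (M →ₗ[R] E) ≪≫ₗ homDualEquivTensor e M ≪≫ₗ
      (TensorProduct.congr (abelianExtZeroEquiv R M R) (LinearEquiv.refl R S)).symm⟩
  | succ i ih =>
    obtain ⟨d, f, hf⟩ := Module.Finite.exists_fin' R M
    have hS := LinearMap.shortExact_shortComplexKer hf
    have hD := LinearMap.shortExact_dual hE f hf
    have := hE.finFunction_dual d
    have : Injective (ModuleCat.of R ((Fin d → R) →ₗ[R] E)) :=
      Module.injective_object_of_injective_module R _
    have : Projective (ModuleCat.of R (Fin d → R)) := inferInstance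
    cases i with
    | zero =>
      have : Module.FinitePresentation R (LinearMap.ker f) :=
        Module.finitePresentation_of_finite R _
      obtain ⟨δ, hδ, hδ0⟩ := exists_covariant_connecting hD (ModuleCat.of R E)
      obtain ⟨δ', hδ', hδ0'⟩ := exists_contravariant_connecting hS (ModuleCat.of R R)
      have hex : Function.Exact (LinearMap.lcomp R R (LinearMap.ker f).subtype) δ' :=
        fun φ => hδ0' φ
      refine LinearMap.nonempty_linearEquiv_of_surjective_of_ker δ hδ (δ'.rTensor S)
        (LinearMap.rTensor_surjective S hδ') (homDualEquivTensor e (LinearMap.ker f)) fun b => ?_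
      rw [hδ0, rTensor_exact S hex hδ']
      constructor
      · rintro ⟨ψ, rfl⟩
        exact ⟨_, (homDualEquivTensor_lcomp e _ ψ).symm⟩
      · rintro ⟨z, hz⟩
        refine ⟨(homDualEquivTensor e _).symm z, ?_⟩
        apply (homDualEquivTensor e (LinearMap.ker f)).injective
        refine (homDualEquivTensor_lcomp e _ _).trans ?_
        rw [LinearEquiv.apply_symm_apply, hz]
    | succ i =>
      obtain ⟨E₀⟩ := ih (LinearMap.ker f)
      exact ⟨(LinearEquiv.ofBijective _
          (postcomp_extClass_bijective hD (ModuleCat.of R E) i)).symm ≪≫ₗ E₀ ≪≫ₗ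
        TensorProduct.congr (LinearEquiv.ofBijective _
          (precomp_extClass_bijective hS (ModuleCat.of R R) i)) (LinearEquiv.refl R S)⟩

end DimensionShifting

/-- Let `R` be a commutative noetherian local ring with residue field `k`,
let `E` be an injective hull of `k` over `R` (an injective `R`-module containing `k` as an
essential submodule), and let `R̂` be the `m`-adic completion.  Then for every `i ≥ 0` there
is an isomorphism of `R`-modules `Ext^i_R(E, k) ≅ Ext^i_R(k, R) ⊗_R R̂`. -/
theorem ext_injective_hull_iso_completion
    (R : Type) [CommRing R] [IsNoetherianRing R] [IsLocalRing R]
    (E : Type) [AddCommGroup E] [Module R E] (hE : Module.Injective R E)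
    (ι : IsLocalRing.ResidueField R →ₗ[R] E) (hι : Function.Injective ι)
    (hess : ∀ N : Submodule R E, N ⊓ LinearMap.range ι = ⊥ → N = ⊥)
    (i : ℕ) :
    Nonempty (ExtGroup R i E (IsLocalRing.ResidueField R) ≃ₗ[R]
      TensorProduct R (ExtGroup R i (IsLocalRing.ResidueField R) R)
        (AdicCompletion (IsLocalRing.maximalIdeal R) R)) := by
  obtain ⟨e⟩ := end_equiv_adicCompletion hE hι hess
  obtain ⟨k⟩ := residueField_dual_equiv hι hess
  have : Module.Flat R (AdicCompletion (IsLocalRing.maximalIdeal R) R) :=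
    AdicCompletion.flat_of_isNoetherian _
  have : Module.Finite R (IsLocalRing.ResidueField R) :=
    Module.Finite.of_surjective (Algebra.linearMap R _) IsLocalRing.residue_surjective
  let E₁ := (((Ext R (ModuleCat R) i).obj (Opposite.op (ModuleCat.of R E))).mapIso
    k.toModuleIso).toLinearEquiv
  obtain ⟨E₂⟩ := ext_linearEquiv_abelianExt (R := R) (ModuleCat.of R E)
    (ModuleCat.of R (IsLocalRing.ResidueField R →ₗ[R] E)) i
  obtain ⟨E₃⟩ := abelianExt_dual_equiv_tensor hE e i (IsLocalRing.ResidueField R)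
  obtain ⟨E₄⟩ := ext_linearEquiv_abelianExt (R := R)
    (ModuleCat.of R (IsLocalRing.ResidueField R)) (ModuleCat.of R R) i
  exact ⟨E₁ ≪≫ₗ E₂ ≪≫ₗ E₃ ≪≫ₗ TensorProduct.congr E₄.symm (LinearEquiv.refl R _)⟩
end
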